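/- Let μ ∈ (1/2,1], β ∈ (0,2], s ≥ −1/2 and T ∈ (0,∞). A tempered distribution g on ℝ^{2n} belongs to X_β^{s+1/2−(1−μ)} if and only if there exists u ∈ T_μ((0,T); X_β^s) ∩ L²_μ((0,T); X_β^{s+1}) whose time-continuous representative satisfies u(0) = g. Moreover, the trace norm ‖g‖_{tr} := inf{ ‖u‖_{T_μ(X_β^s)} + ‖u‖_{L²_μ(X_β^{s+1})} : u ∈ T_μ((0,T);X_β^s) ∩ L²_μ((0,T);X_β^{s+1}), u(0) = g } is equivalent to the norm of X_β^{s+1/2−(1−μ)}: there exist constants C₁, C₂ > 0 with C₁‖g‖_{X_β^{s+1/2−(1−μ)}} ≤ ‖g‖_{tr} ≤ C₂‖g‖_{X_β^{s+1/2−(1−μ)}}. -/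

import Mathlib

open MeasureTheory Set Filter
open scoped ENNReal

noncomputable section

/-- `ℝⁿ` with the Euclidean norm. -/
abbrev En (n : ℕ) : Type := EuclideanSpace ℝ (Fin n)

/-- `ω_β(k,ξ) = 1 + ‖k‖^{β/(β+1)} + ‖ξ‖^β`. -/
def omegaB (n : ℕ) (β : ℝ) (k ξ : En n) : ℝ := 1 + ‖k‖ ^ (β / (β + 1)) + ‖ξ‖ ^ β

/-- Squared norm of the anisotropic Sobolev space `X_β^s`, on the Fourier side:
`w` is the Fourier transform `û(k,ξ)`. -/
def Xnorm (n : ℕ) (β s : ℝ) (w : En n → En n → ℂ) : ℝ≥0∞ :=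
  ∫⁻ (k : En n), ∫⁻ (ξ : En n), ENNReal.ofReal (omegaB n β k ξ ^ (2 * s) * ‖w k ξ‖ ^ 2)

/-- Squared norm of `L²_μ((0,T); X_β^s)`, on the Fourier side. -/
def L2X (n : ℕ) (β s T μ : ℝ) (U : ℝ → En n → En n → ℂ) : ℝ≥0∞ :=
  ∫⁻ t in Ioo 0 T, ENNReal.ofReal (t ^ (2 - 2*μ)) * Xnorm n β s (U t)

/-- The Fourier side of the kinetic transport derivative: `Ĥ = ∂_t Û − k·∇_ξ Û` in the
sense of distributions on `(0,T) × ℝ^{2n}` (a point of `ℝ^{2n}` is `q = (k,ξ)`); this is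
the Fourier transform of `h = ∂_t u + v·∇ₓ u`. -/
def IsFTransportDeriv (n : ℕ) (T : ℝ) (U H : ℝ → En n → En n → ℂ) : Prop :=
  ∀ φ : ℝ × (En n × En n) → ℝ, ContDiff ℝ ((⊤ : ℕ∞) : WithTop ℕ∞) φ → HasCompactSupport φ →
    (∀ p : ℝ × (En n × En n), p.1 ∉ Ioo 0 T → φ p = 0) →
    -(∫ t in Ioo 0 T, ∫ q : En n × En n,
        U t q.1 q.2 * (fderiv ℝ φ (t, q) ((1 : ℝ), ((0 : En n), -q.1)) : ℂ))
      = ∫ t in Ioo 0 T, ∫ q : En n × En n, H t q.1 q.2 * (φ (t, q) : ℂ)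

/-- Joint measurability of `U : ℝ → En n → En n → ℂ`. -/
def MeasU (n : ℕ) (U : ℝ → En n → En n → ℂ) : Prop :=
  Measurable (fun p : ℝ × En n × En n => U p.1 p.2.1 p.2.2)

/-- Squared `H^{-1}(ℝ^{2n})` norm, on the Fourier side. -/
def Hm1 (n : ℕ) (w : En n → En n → ℂ) : ℝ≥0∞ :=
  ∫⁻ (k : En n), ∫⁻ (ξ : En n), ENNReal.ofReal ((1 + ‖k‖ ^ 2 + ‖ξ‖ ^ 2)⁻¹ * ‖w k ξ‖ ^ 2)

/-- Membership `u ∈ T_μ((0,T);X_β^s) ∩ L²_μ((0,T);X_β^{s+1})`, on the Fourier side,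
where `H` is the (Fourier side) transport derivative `∂_t u + v·∇ₓ u` of `u`. -/
def SolSpace (n : ℕ) (β s T μ : ℝ) (U H : ℝ → En n → En n → ℂ) : Prop :=
  MeasU n U ∧ MeasU n H ∧ IsFTransportDeriv n T U H ∧
    L2X n β s T μ U < ⊤ ∧ L2X n β s T μ H < ⊤ ∧ L2X n β (s + 1) T μ U < ⊤

/-- The time-continuous representative of `u` has trace `g` at `t = 0`:
`u(t) → g` in `H^{-1}(ℝ^{2n})` as `t → 0⁺`. -/
def HasTrace (n : ℕ) (T : ℝ) (U : ℝ → En n → En n → ℂ) (G : En n → En n → ℂ) : Prop :=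
  Tendsto (fun t : ℝ => Hm1 n (fun k ξ => U t k ξ - G k ξ)) (nhdsWithin 0 (Ioo 0 T)) (nhds 0)

/-- The trace norm: infimum of the `T_μ((0,T);X_β^s) ∩ L²_μ((0,T);X_β^{s+1})` norms over
all functions with trace `G` at `t = 0`. -/
def traceNorm (n : ℕ) (β s T μ : ℝ) (G : En n → En n → ℂ) : ℝ≥0∞ :=
  sInf { N : ℝ≥0∞ | ∃ U H : ℝ → En n → En n → ℂ,
    SolSpace n β s T μ U H ∧ HasTrace n T U G ∧
    N = (L2X n β s T μ U) ^ ((1:ℝ)/2) + (L2X n β s T μ H) ^ ((1:ℝ)/2)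
        + (L2X n β (s + 1) T μ U) ^ ((1:ℝ)/2) }

/-- The shear `(k, ξ) ↦ (k, ξ + t k)`, i.e. free transport on the Fourier side. -/
def shear {n : ℕ} (t : ℝ) (q : En n × En n) : En n × En n := (q.1, q.2 + t • q.1)

/-- The weight `ω_β` as a function on phase space. -/
def om {n : ℕ} (β : ℝ) (q : En n × En n) : ℝ := omegaB n β q.1 q.2

/-- The weight defining `H^{-1}`. -/
def hWeight {n : ℕ} (q : En n × En n) : ℝ := (1 + ‖q.1‖ ^ 2 + ‖q.2‖ ^ 2)⁻¹

/-- `U` followed along the characteristics of free transport. -/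
def comoving {n : ℕ} (U : ℝ → En n → En n → ℂ) (t : ℝ) (q : En n × En n) : ℂ :=
  U t (shear (-t) q).1 (shear (-t) q).2

/-- The weighted energy in time of `V` along the characteristic through `q`. -/
def energy {n : ℕ} (β s T μ : ℝ) (V : ℝ → En n × En n → ℂ) (q : En n × En n) : ℝ≥0∞ :=
  ∫⁻ t in Ioo 0 T, ENNReal.ofReal (t ^ (2 - 2 * μ)) *
    (ENNReal.ofReal (om β (shear (-t) q) ^ (2 * s)) * ‖V t q‖ₑ ^ 2)

section Shear

variable {n : ℕ}

lemma shear_shear (a b : ℝ) (q : En n × En n) : shear a (shear b q) = shear (a + b) q := by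
  simp only [shear, add_smul, Prod.mk.injEq, true_and]
  abel

@[simp] lemma shear_zero (q : En n × En n) : shear 0 q = q := by simp [shear]

@[simp] lemma shear_neg_shear (t : ℝ) (q : En n × En n) : shear (-t) (shear t q) = q := by
  simp [shear_shear]

@[simp] lemma shear_shear_neg (t : ℝ) (q : En n × En n) : shear t (shear (-t) q) = q := by
  simp [shear_shear]

@[fun_prop] lemma continuous_shear {Y : Type*} [TopologicalSpace Y] {f : Y → ℝ}
    {g : Y → En n × En n} (hf : Continuous f) (hg : Continuous g) :
    Continuous fun y => shear (f y) (g y) := by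
  unfold shear; fun_prop

@[fun_prop] lemma measurable_shear {Y : Type*} [MeasurableSpace Y] {f : Y → ℝ}
    {g : Y → En n × En n} (hf : Measurable f) (hg : Measurable g) :
    Measurable fun y => shear (f y) (g y) := by
  unfold shear; fun_prop

lemma contDiff_shear {Y : Type*} [NormedAddCommGroup Y] [NormedSpace ℝ Y] {m : WithTop ℕ∞}
    {f : Y → ℝ} {g : Y → En n × En n} (hf : ContDiff ℝ m f) (hg : ContDiff ℝ m g) :
    ContDiff ℝ m fun y => shear (f y) (g y) := by
  unfold shear; fun_prop

lemma measurePreserving_shear (t : ℝ) :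
    MeasurePreserving (shear t : En n × En n → En n × En n) volume volume := by
  refine MeasurePreserving.skew_product (f := id) (g := fun k ξ => ξ + t • k)
    (MeasurePreserving.id _) (by unfold Function.uncurry; fun_prop) (ae_of_all _ fun k => ?_)
  exact (measurePreserving_add_right volume (t • k)).map_eq

/-- The shear as a homeomorphism. -/
def shearHomeo (t : ℝ) : (En n × En n) ≃ₜ (En n × En n) where
  toFun := shear t
  invFun := shear (-t)
  left_inv q := by simp
  right_inv q := by simp
  continuous_toFun := by fun_prop
  continuous_invFun := by fun_prop

lemma measurableEmbedding_shear (t : ℝ) :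
    MeasurableEmbedding (shear t : En n × En n → En n × En n) :=
  (shearHomeo t).measurableEmbedding

lemma lintegral_shear (t : ℝ) (f : En n × En n → ℝ≥0∞) :
    ∫⁻ q, f (shear t q) = ∫⁻ q, f q :=
  (measurePreserving_shear t).lintegral_comp_emb (measurableEmbedding_shear t) f

lemma integral_shear (t : ℝ) (f : En n × En n → ℂ) :
    ∫ q, f (shear t q) = ∫ q, f q :=
  (measurePreserving_shear t).integral_comp (measurableEmbedding_shear t) f

end Shear

section Weights

variable {n : ℕ} {β : ℝ}

lemma one_le_om (q : En n × En n) : 1 ≤ om β q := by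
  have h1 := Real.rpow_nonneg (norm_nonneg q.1) (β / (β + 1))
  have h2 := Real.rpow_nonneg (norm_nonneg q.2) β
  unfold om omegaB; linarith

lemma om_pos (q : En n × En n) : 0 < om β q := one_pos.trans_le (one_le_om q)

lemma continuous_om (hβ : 0 < β) : Continuous (om β : En n × En n → ℝ) := by
  unfold om omegaB
  have h : 0 ≤ β / (β + 1) := by positivity
  exact (continuous_const.add (continuous_fst.norm.rpow_const fun _ => Or.inr h)).add
    (continuous_snd.norm.rpow_const fun _ => Or.inr hβ.le)

lemma continuous_om_rpow (hβ : 0 < β) (p : ℝ) :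
    Continuous fun q : En n × En n => om β q ^ p :=
  (continuous_om hβ).rpow_const fun q => Or.inl (om_pos q).ne'

lemma hWeight_pos (q : En n × En n) : 0 < hWeight q := by unfold hWeight; positivity

lemma continuous_hWeight : Continuous (hWeight : En n × En n → ℝ) := by
  unfold hWeight
  exact Continuous.inv₀ (by fun_prop) fun q => by positivity

lemma hWeight_shear_le {t : ℝ} (ht : |t| ≤ 1) (q : En n × En n) :
    hWeight (shear t q) ≤ 3 * hWeight q := by
  have h1 : ‖q.2‖ ≤ ‖q.2 + t • q.1‖ + ‖q.1‖ := by
    calc ‖q.2‖ = ‖(q.2 + t • q.1) - t • q.1‖ := by simp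
      _ ≤ ‖q.2 + t • q.1‖ + ‖t • q.1‖ := norm_sub_le _ _
      _ ≤ _ := by
        rw [norm_smul, Real.norm_eq_abs]
        gcongr
        exact mul_le_of_le_one_left (norm_nonneg _) ht
  unfold hWeight shear
  have h0 := norm_nonneg q.1
  have h2 := norm_nonneg q.2
  have h3 := norm_nonneg (q.2 + t • q.1)
  rw [← div_eq_mul_inv, inv_eq_one_div, div_le_div_iff₀ (by positivity) (by positivity)]
  nlinarith [sq_nonneg (‖q.2 + t • q.1‖ - ‖q.1‖), mul_self_le_mul_self h2 h1]

lemma rpow_le_one_add_sq {x p : ℝ} (hx : 0 ≤ x) (hp : 0 ≤ p) (hp2 : p ≤ 2) :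
    x ^ p ≤ 1 + x ^ 2 := by
  rcases le_total x 1 with h | h
  · have := Real.rpow_le_one hx h hp
    nlinarith [sq_nonneg x]
  · have := Real.rpow_le_rpow_of_exponent_le h hp2
    rw [Real.rpow_two] at this
    linarith

lemma hWeight_le_om_rpow (hβ : β ∈ Ioc (0 : ℝ) 2) {p : ℝ} (hp : -1 ≤ p) (q : En n × En n) :
    hWeight q ≤ 3 * om β q ^ p := by
  have h1 : om β q ≤ 3 * (1 + ‖q.1‖ ^ 2 + ‖q.2‖ ^ 2) := by
    have hb : β / (β + 1) ≤ 2 := by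
      rw [div_le_iff₀ (by linarith [hβ.1])]; linarith [hβ.1]
    have h1 := rpow_le_one_add_sq (norm_nonneg q.1)
      (div_nonneg hβ.1.le (by linarith [hβ.1] : 0 ≤ β + 1)) hb
    have h2 := rpow_le_one_add_sq (norm_nonneg q.2) hβ.1.le hβ.2
    unfold om omegaB
    nlinarith [sq_nonneg ‖q.1‖, sq_nonneg ‖q.2‖]
  have h2 : (om β q)⁻¹ ≤ om β q ^ p := by
    rw [← Real.rpow_neg_one]
    exact Real.rpow_le_rpow_of_exponent_le (one_le_om q) hp
  refine le_trans ?_ (mul_le_mul_of_nonneg_left h2 (by norm_num))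
  unfold hWeight
  rw [← div_eq_mul_inv, inv_eq_one_div, div_le_div_iff₀ (by positivity) (om_pos q)]
  linarith

lemma om_shear_le (hβ : β ∈ Ioc (0 : ℝ) 2) {t : ℝ} {q : En n × En n}
    (ht : |t| * om β q ≤ 1) : om β (shear t q) ≤ 8 * om β q := by
  obtain ⟨hb, hb2⟩ := hβ
  set k := ‖q.1‖ with hk
  have hk0 : 0 ≤ k := norm_nonneg _
  have hω : 0 < om β q := om_pos q
  have hω1 : 1 ≤ om β q := one_le_om q
  have h1 : k ^ (β / (β + 1)) ≤ om β q := by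
    have h2 := Real.rpow_nonneg (norm_nonneg q.2) β
    unfold om omegaB; linarith
  have htk : (|t| * k) ^ β ≤ om β q := by
    have ht' : |t| ≤ (om β q)⁻¹ := by rwa [← one_div, le_div_iff₀ hω]
    have h3 : k ≤ om β q ^ ((β + 1) / β) := by
      calc k = (k ^ (β / (β + 1))) ^ ((β + 1) / β) := by
            rw [← Real.rpow_mul hk0]
            rw [show β / (β + 1) * ((β + 1) / β) = 1 by field_simp, Real.rpow_one]
        _ ≤ _ := Real.rpow_le_rpow (by positivity) h1 (by positivity)
    calc (|t| * k) ^ β ≤ ((om β q)⁻¹ * om β q ^ ((β + 1) / β)) ^ β := by gcongr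
      _ = om β q := by
        rw [← Real.rpow_neg_one, ← Real.rpow_add hω, ← Real.rpow_mul hω.le]
        rw [show (-1 + (β + 1) / β) * β = 1 by field_simp; ring, Real.rpow_one]
  have hsum : ‖q.2 + t • q.1‖ ^ β ≤ 4 * (‖q.2‖ ^ β + (|t| * k) ^ β) := by
    have hM : ‖q.2 + t • q.1‖ ≤ 2 * max ‖q.2‖ (|t| * k) := by
      calc _ ≤ ‖q.2‖ + ‖t • q.1‖ := norm_add_le _ _
        _ = ‖q.2‖ + |t| * k := by rw [norm_smul, Real.norm_eq_abs]
        _ ≤ _ := by linarith [le_max_left ‖q.2‖ (|t| * k), le_max_right ‖q.2‖ (|t| * k)]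
    have hmax : (max ‖q.2‖ (|t| * k)) ^ β ≤ ‖q.2‖ ^ β + (|t| * k) ^ β := by
      have e1 : 0 ≤ ‖q.2‖ ^ β := by positivity
      have e2 : 0 ≤ (|t| * k) ^ β := by positivity
      rcases max_cases ‖q.2‖ (|t| * k) with ⟨h, _⟩ | ⟨h, _⟩ <;> rw [h] <;> linarith
    have h24 : (2 : ℝ) ^ β ≤ 4 := by
      calc (2 : ℝ) ^ β ≤ 2 ^ (2 : ℝ) := Real.rpow_le_rpow_of_exponent_le (by norm_num) hb2
        _ = 4 := by norm_num
    calc _ ≤ (2 * max ‖q.2‖ (|t| * k)) ^ β := Real.rpow_le_rpow (norm_nonneg _) hM hb.le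
      _ = 2 ^ β * (max ‖q.2‖ (|t| * k)) ^ β := Real.mul_rpow (by norm_num) (by positivity)
      _ ≤ _ := mul_le_mul h24 hmax (by positivity) (by norm_num)
  have h0 : 0 ≤ k ^ (β / (β + 1)) := by positivity
  have hdef : om β q = 1 + k ^ (β / (β + 1)) + ‖q.2‖ ^ β := rfl
  have hdef' : om β (shear t q) = 1 + k ^ (β / (β + 1)) + ‖q.2 + t • q.1‖ ^ β := rfl
  have := Real.rpow_nonneg (norm_nonneg q.2) β
  linarith

lemma om_le_shear (hβ : β ∈ Ioc (0 : ℝ) 2) {t : ℝ} {q : En n × En n}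
    (ht : |t| * om β q ≤ 1) : om β q ≤ 8 * om β (shear t q) := by
  rcases le_total (om β q) (om β (shear t q)) with h | h
  · linarith [om_pos (β := β) (shear t q)]
  · have h' : |-t| * om β (shear t q) ≤ 1 := by
      rw [abs_neg]
      exact (mul_le_mul_of_nonneg_left h (abs_nonneg t)).trans ht
    simpa using om_shear_le hβ h'

lemma rpow_le_of_comparable {a b p : ℝ} (ha : 0 < a) (hb : 0 < b) (hab : a ≤ 8 * b)
    (hba : b ≤ 8 * a) : a ^ p ≤ 8 ^ |p| * b ^ p := by
  rcases le_total 0 p with hp | hp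
  · rw [abs_of_nonneg hp, ← Real.mul_rpow (by norm_num) hb.le]
    exact Real.rpow_le_rpow ha.le hab hp
  · rw [abs_of_nonpos hp]
    have h : a ^ p ≤ (b / 8) ^ p :=
      Real.rpow_le_rpow_of_nonpos (by positivity) (by linarith) hp
    rwa [Real.div_rpow hb.le (by norm_num), div_eq_mul_inv, ← Real.rpow_neg (by norm_num),
      mul_comm] at h

lemma om_rpow_shear_le (hβ : β ∈ Ioc (0 : ℝ) 2) {t : ℝ} {q : En n × En n}
    (ht : |t| * om β q ≤ 1) (p : ℝ) : om β (shear t q) ^ p ≤ 8 ^ |p| * om β q ^ p :=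
  rpow_le_of_comparable (om_pos _) (om_pos _) (om_shear_le hβ ht) (om_le_shear hβ ht)

lemma om_rpow_le_shear (hβ : β ∈ Ioc (0 : ℝ) 2) {t : ℝ} {q : En n × En n}
    (ht : |t| * om β q ≤ 1) (p : ℝ) : om β q ^ p ≤ 8 ^ |p| * om β (shear t q) ^ p :=
  rpow_le_of_comparable (om_pos _) (om_pos _) (om_le_shear hβ ht) (om_shear_le hβ ht)

end Weights

section Norms

variable {n : ℕ} {β s T μ : ℝ}

lemma Xnorm_eq (hβ : 0 < β) {w : En n → En n → ℂ}
    (hw : Measurable fun q : En n × En n => w q.1 q.2) :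
    Xnorm n β s w = ∫⁻ q : En n × En n, ENNReal.ofReal (om β q ^ (2 * s)) * ‖w q.1 q.2‖ₑ ^ 2 := by
  have hm : Measurable fun q : En n × En n =>
      ENNReal.ofReal (om β q ^ (2 * s)) * ‖w q.1 q.2‖ₑ ^ 2 :=
    (continuous_om_rpow hβ _).measurable.ennreal_ofReal.mul (hw.enorm.pow_const 2)
  rw [Measure.volume_eq_prod, lintegral_prod _ hm.aemeasurable]
  unfold Xnorm
  refine lintegral_congr fun k => lintegral_congr fun ξ => ?_
  change ENNReal.ofReal (om β (k, ξ) ^ (2 * s) * ‖w k ξ‖ ^ 2) = _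
  rw [ENNReal.ofReal_mul (Real.rpow_nonneg (om_pos _).le _),
    ENNReal.ofReal_pow (norm_nonneg _), ofReal_norm]

lemma Hm1_eq {w : En n → En n → ℂ} (hw : Measurable fun q : En n × En n => w q.1 q.2) :
    Hm1 n w = ∫⁻ q : En n × En n, ENNReal.ofReal (hWeight q) * ‖w q.1 q.2‖ₑ ^ 2 := by
  have hm : Measurable fun q : En n × En n =>
      ENNReal.ofReal (hWeight q) * ‖w q.1 q.2‖ₑ ^ 2 :=
    continuous_hWeight.measurable.ennreal_ofReal.mul (hw.enorm.pow_const 2)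
  rw [Measure.volume_eq_prod, lintegral_prod _ hm.aemeasurable]
  unfold Hm1
  refine lintegral_congr fun k => lintegral_congr fun ξ => ?_
  change ENNReal.ofReal (hWeight (k, ξ) * ‖w k ξ‖ ^ 2) = _
  rw [ENNReal.ofReal_mul (hWeight_pos _).le, ENNReal.ofReal_pow (norm_nonneg _), ofReal_norm]

lemma Hm1_le_Xnorm (hβ : β ∈ Ioc (0 : ℝ) 2) (hs : -1 ≤ 2 * s) {w : En n → En n → ℂ}
    (hw : Measurable fun q : En n × En n => w q.1 q.2) :
    Hm1 n w ≤ 3 * Xnorm n β s w := by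
  rw [Hm1_eq hw, Xnorm_eq hβ.1 hw, ← lintegral_const_mul' _ _ (by norm_num)]
  refine lintegral_mono fun q => ?_
  rw [← mul_assoc]
  gcongr
  calc _ ≤ ENNReal.ofReal (3 * om β q ^ (2 * s)) :=
        ENNReal.ofReal_le_ofReal (hWeight_le_om_rpow hβ hs q)
    _ = _ := by rw [ENNReal.ofReal_mul (by norm_num)]; norm_num

lemma measurable_comoving {U : ℝ → En n → En n → ℂ} (hU : MeasU n U) :
    Measurable fun p : ℝ × (En n × En n) => comoving U p.1 p.2 := by
  unfold comoving
  exact Measurable.comp (g := fun p : ℝ × En n × En n => U p.1 p.2.1 p.2.2) hU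
    (f := fun p : ℝ × En n × En n => (p.1, shear (-p.1) p.2)) (by fun_prop)

lemma MeasU.apply {U : ℝ → En n → En n → ℂ} (hU : MeasU n U) (t : ℝ) :
    Measurable fun q : En n × En n => U t q.1 q.2 :=
  Measurable.comp (g := fun p : ℝ × En n × En n => U p.1 p.2.1 p.2.2) hU
    (f := fun q : En n × En n => (t, q)) (by fun_prop)

lemma measurable_energy_integrand (hβ : 0 < β) {V : ℝ → En n × En n → ℂ}
    (hV : Measurable fun p : ℝ × (En n × En n) => V p.1 p.2) :
    Measurable fun p : ℝ × (En n × En n) => ENNReal.ofReal (p.1 ^ (2 - 2 * μ)) *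
      (ENNReal.ofReal (om β (shear (-p.1) p.2) ^ (2 * s)) * ‖V p.1 p.2‖ₑ ^ 2) := by
  refine (measurable_fst.pow_const _).ennreal_ofReal.mul
    (Measurable.mul (Measurable.ennreal_ofReal ?_) (hV.enorm.pow_const 2))
  exact (continuous_om_rpow hβ _).measurable.comp (by fun_prop)

lemma measurable_energy (hβ : 0 < β) {V : ℝ → En n × En n → ℂ}
    (hV : Measurable fun p : ℝ × (En n × En n) => V p.1 p.2) :
    Measurable (energy β s T μ V) :=
  (measurable_energy_integrand hβ hV).lintegral_prod_left'

lemma L2X_eq (hβ : 0 < β) {U : ℝ → En n → En n → ℂ} (hU : MeasU n U) :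
    L2X n β s T μ U = ∫⁻ q, energy β s T μ (comoving U) q := by
  have hm := measurable_energy_integrand (s := s) (μ := μ) hβ (measurable_comoving hU)
  unfold energy
  rw [← lintegral_lintegral_swap (f := fun t q => ENNReal.ofReal (t ^ (2 - 2 * μ)) *
    (ENNReal.ofReal (om β (shear (-t) q) ^ (2 * s)) * ‖comoving U t q‖ₑ ^ 2)) hm.aemeasurable]
  unfold L2X
  refine lintegral_congr fun t => ?_
  rw [Xnorm_eq hβ (hU.apply t), lintegral_const_mul' _ _ ENNReal.ofReal_ne_top,
    ← lintegral_shear (-t)]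
  rfl

lemma energy_mono_exponent {s' : ℝ} (hs : s ≤ s') {V : ℝ → En n × En n → ℂ} (q : En n × En n) :
    energy β s T μ V q ≤ energy β s' T μ V q := by
  unfold energy
  gcongr with t
  exact one_le_om _

end Norms

section Translation

variable {n : ℕ}

lemma ENNReal.add_sq_le_four (a b : ℝ≥0∞) : (a + b) ^ 2 ≤ 4 * (a ^ 2 + b ^ 2) := by
  rcases le_total a b with h | h
  · calc (a + b) ^ 2 ≤ (b + b) ^ 2 := by gcongr
      _ = 4 * b ^ 2 := by ring
      _ ≤ _ := by gcongr; exact le_add_self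
  · calc (a + b) ^ 2 ≤ (a + a) ^ 2 := by gcongr
      _ = 4 * a ^ 2 := by ring
      _ ≤ _ := by gcongr; exact le_self_add

lemma enorm_add_sq_le_four (a b : ℂ) : ‖a + b‖ₑ ^ 2 ≤ 4 * (‖a‖ₑ ^ 2 + ‖b‖ₑ ^ 2) :=
  (pow_le_pow_left₀ zero_le (enorm_add_le a b) 2).trans (ENNReal.add_sq_le_four _ _)

lemma ofReal_mul_enorm_sq {a : ℝ} (ha : 0 ≤ a) (z : ℂ) :
    ENNReal.ofReal a * ‖z‖ₑ ^ 2 = ‖(√a : ℂ) * z‖ₑ ^ 2 := by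
  rw [enorm_mul, mul_pow, ← ofReal_norm (√a : ℂ), Complex.norm_real, Real.norm_eq_abs,
    abs_of_nonneg (Real.sqrt_nonneg a), ← ENNReal.ofReal_pow (Real.sqrt_nonneg a),
    Real.sq_sqrt ha]

lemma tendsto_lintegral_shear_sub {F : En n × En n → ℂ} (hF : MemLp F 2 volume) :
    Tendsto (fun t : ℝ => ∫⁻ q, ‖F (shear t q) - F q‖ₑ ^ 2) (nhds 0) (nhds 0) := by
  have hcont : Continuous fun t : ℝ =>
      (⟨shear t, by fun_prop⟩ : C(En n × En n, En n × En n)) :=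
    ContinuousMap.continuous_of_continuous_uncurry _ (by
      change Continuous fun p : ℝ × (En n × En n) => shear p.1 p.2
      fun_prop)
  have h := (continuous_const (y := hF.toLp F)).compMeasurePreservingLp hcont
    (fun t => measurePreserving_shear t) (by norm_num : (2 : ℝ≥0∞) ≠ ⊤)
  have h1 := (tendsto_iff_edist_tendsto_0.1 (h.tendsto 0))
  have h2 := ENNReal.Tendsto.pow (n := 2) h1
  rw [zero_pow two_ne_zero] at h2
  refine h2.congr fun t => ?_
  have hae (r : ℝ) : Lp.compMeasurePreserving (shear r) (measurePreserving_shear r) (hF.toLp F)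
      =ᵐ[volume] fun q => F (shear r q) :=
    (Lp.coeFn_compMeasurePreserving _ _).trans
      ((measurePreserving_shear r).quasiMeasurePreserving.ae_eq_comp hF.coeFn_toLp)
  rw [Lp.edist_def, eLpNorm_eq_lintegral_rpow_enorm_toReal (by norm_num) (by norm_num)]
  simp only [ENNReal.toReal_ofNat, ENNReal.rpow_ofNat]
  rw [← ENNReal.rpow_natCast, ← ENNReal.rpow_mul]
  norm_num
  refine lintegral_congr_ae ?_
  filter_upwards [hae t, hae 0] with q h3 h4
  rw [shear_zero] at h4
  rw [← h3, ← h4]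
  rfl

lemma tendsto_hWeight_shear_sub {G : En n × En n → ℂ} (hG : Measurable G)
    (hfin : ∫⁻ q, ENNReal.ofReal (hWeight q) * ‖G q‖ₑ ^ 2 < ⊤) :
    Tendsto (fun t : ℝ => ∫⁻ q, ENNReal.ofReal (hWeight q) * ‖G (shear t q) - G q‖ₑ ^ 2)
      (nhds 0) (nhds 0) := by
  set F : En n × En n → ℂ := fun q => (√(hWeight q) : ℂ) * G q with hFdef
  have hsq : Continuous fun q : En n × En n => √(hWeight q) := continuous_hWeight.sqrt
  have hFm : Measurable F := by
    exact (Complex.measurable_ofReal.comp hsq.measurable).mul hG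
  have hF : MemLp F 2 volume := by
    refine ⟨hFm.aestronglyMeasurable, ?_⟩
    rw [eLpNorm_lt_top_iff_lintegral_rpow_enorm_lt_top (by norm_num) (by norm_num)]
    refine lt_of_eq_of_lt (lintegral_congr fun q => ?_) hfin
    rw [ofReal_mul_enorm_sq (hWeight_pos q).le]
    simp only [ENNReal.toReal_ofNat, ENNReal.rpow_ofNat, hFdef]
  have h1 := tendsto_lintegral_shear_sub hF
  have h2 : Tendsto (fun t : ℝ => ∫⁻ q, ENNReal.ofReal
      ((√(hWeight (shear (-t) q)) - √(hWeight q)) ^ 2) * ‖G q‖ₑ ^ 2) (nhds 0) (nhds 0) := by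
    have hz : ∫⁻ q : En n × En n, (0 : ℝ≥0∞) = 0 := by simp
    rw [← hz]
    refine tendsto_lintegral_filter_of_dominated_convergence
      (fun q => 4 * (ENNReal.ofReal (hWeight q) * ‖G q‖ₑ ^ 2)) ?_ ?_ ?_ ?_
    · refine Eventually.of_forall fun t => Measurable.mul ?_ (hG.enorm.pow_const 2)
      refine Measurable.ennreal_ofReal (Continuous.measurable ?_)
      exact ((hsq.comp (by fun_prop : Continuous (shear (-t)))).sub hsq).pow 2
    · filter_upwards [Metric.ball_mem_nhds (0 : ℝ) one_pos] with t ht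
      refine ae_of_all _ fun q => ?_
      rw [← mul_assoc]
      gcongr
      rw [show (4 : ℝ≥0∞) = ENNReal.ofReal 4 by norm_num, ← ENNReal.ofReal_mul (by norm_num)]
      refine ENNReal.ofReal_le_ofReal ?_
      have ht' : |-t| ≤ 1 := by rw [abs_neg]; simpa using (mem_ball_zero_iff.1 ht).le
      have h3 := hWeight_shear_le ht' q
      have e1 := Real.sq_sqrt (hWeight_pos q).le
      have e2 := Real.sq_sqrt (hWeight_pos (shear (-t) q)).le
      nlinarith [mul_nonneg (Real.sqrt_nonneg (hWeight q))
        (Real.sqrt_nonneg (hWeight (shear (-t) q)))]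
    · rw [lintegral_const_mul' _ _ (by norm_num)]
      exact (ENNReal.mul_lt_top (by norm_num) hfin).ne
    · refine ae_of_all _ fun q => ?_
      have hc : Continuous fun t : ℝ => (√(hWeight (shear (-t) q)) - √(hWeight q)) ^ 2 :=
        ((hsq.comp (by fun_prop : Continuous fun t : ℝ => shear (-t) q)).sub
          continuous_const).pow 2
      have := ENNReal.Tendsto.mul_const (b := ‖G q‖ₑ ^ 2)
        (ENNReal.tendsto_ofReal (hc.tendsto 0)) (Or.inr (by finiteness))
      simpa using this
  have h3 := ENNReal.Tendsto.const_mul (a := 4) (h2.add h1) (Or.inr (by norm_num))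
  rw [add_zero, mul_zero] at h3
  refine tendsto_of_tendsto_of_tendsto_of_le_of_le tendsto_const_nhds h3
    (fun _ => zero_le) fun t => ?_
  have h4 : ∫⁻ q, ENNReal.ofReal
      ((√(hWeight (shear (-t) q)) - √(hWeight q)) ^ 2) * ‖G q‖ₑ ^ 2 =
      ∫⁻ q, ‖((√(hWeight q) : ℂ) - √(hWeight (shear t q))) * G (shear t q)‖ₑ ^ 2 := by
    rw [← lintegral_shear t]
    refine lintegral_congr fun q => ?_
    rw [ofReal_mul_enorm_sq (sq_nonneg _), shear_neg_shear, Real.sqrt_sq_eq_abs, enorm_mul,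
      enorm_mul]
    congr 2
    rw [← ofReal_norm, ← ofReal_norm, Complex.norm_real, ← Complex.ofReal_sub, Complex.norm_real,
      Real.norm_eq_abs, Real.norm_eq_abs, abs_abs]
  simp only
  rw [h4, ← lintegral_add_right _ (by
    refine Measurable.pow_const (Measurable.enorm ?_) 2
    exact (hFm.comp (by fun_prop : Measurable (shear t))).sub hFm),
    ← lintegral_const_mul' _ _ (by norm_num)]
  refine lintegral_mono fun q => ?_
  rw [ofReal_mul_enorm_sq (hWeight_pos q).le]
  refine le_trans (le_of_eq ?_) (enorm_add_sq_le_four _ _)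
  congr 2
  simp only [hFdef]
  ring

end Translation

section Integrability

variable {n : ℕ} {β s T μ : ℝ}

lemma integrableOn_rpow_Ioo {a T : ℝ} (ha : a < 1) (hT : 0 < T) :
    IntegrableOn (fun t : ℝ => t ^ (-a)) (Ioo 0 T) volume := by
  have h := intervalIntegral.intervalIntegrable_rpow' (a := 0) (b := T) (r := -a) (by linarith)
  rw [intervalIntegrable_iff_integrableOn_Ioo_of_le hT.le] at h
  exact h

lemma le_mul_sq_add_inv {x y : ℝ} (hx : 0 ≤ x) (hy : 0 < y) : x ≤ y * x ^ 2 + y⁻¹ := by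
  rcases le_total (x * y) 1 with h | h
  · have : x ≤ y⁻¹ := by rwa [← one_div, le_div_iff₀ hy]
    nlinarith [mul_nonneg hy.le (sq_nonneg x)]
  · have : 0 < y⁻¹ := by positivity
    nlinarith

lemma integrable_of_energy (hβ : 0 < β) (hμ : 1 / 2 < μ) (hT : 0 < T)
    {V : ℝ → En n × En n → ℂ} (hV : Measurable fun p : ℝ × (En n × En n) => V p.1 p.2)
    (hE : ∫⁻ q, energy β s T μ V q < ⊤) {Q : Set (En n × En n)} (hQ : IsCompact Q) :
    Integrable (fun p : ℝ × (En n × En n) => V p.1 p.2)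
      ((volume.restrict (Ioo 0 T)).prod (volume.restrict Q)) := by
  obtain ⟨C, hC⟩ : ∃ C : ℝ, ∀ p ∈ Icc 0 T ×ˢ Q,
      ‖om β (shear (-p.1) p.2) ^ (-(2 * s))‖ ≤ C :=
    (isCompact_Icc.prod hQ).exists_bound_of_continuousOn
      ((continuous_om_rpow hβ _).comp (by fun_prop)).continuousOn
  refine ⟨hV.aestronglyMeasurable, ?_⟩
  have hm := measurable_energy_integrand (s := s) (μ := μ) hβ hV
  have hbound : ∀ᵐ p ∂((volume.restrict (Ioo 0 T)).prod (volume.restrict Q)),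
      ‖V p.1 p.2‖ₑ ≤ ENNReal.ofReal (p.1 ^ (2 - 2 * μ)) *
        (ENNReal.ofReal (om β (shear (-p.1) p.2) ^ (2 * s)) * ‖V p.1 p.2‖ₑ ^ 2) +
        ENNReal.ofReal (p.1 ^ (-(2 - 2 * μ))) * ENNReal.ofReal C := by
    rw [Measure.prod_restrict]
    filter_upwards [ae_restrict_mem (measurableSet_Ioo.prod hQ.measurableSet)] with p hp
    have hpos : 0 < p.1 := hp.1.1
    have hCp := (Real.le_norm_self _).trans (hC p ⟨Ioo_subset_Icc_self hp.1, hp.2⟩)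
    have hw : 0 < om β (shear (-p.1) p.2) ^ (2 * s) := Real.rpow_pos_of_pos (om_pos _) _
    have ha : 0 < p.1 ^ (2 - 2 * μ) := Real.rpow_pos_of_pos hpos _
    have key := le_mul_sq_add_inv (norm_nonneg (V p.1 p.2)) (mul_pos ha hw)
    rw [← ofReal_norm, ← ENNReal.ofReal_pow (norm_nonneg _), ← ENNReal.ofReal_mul hw.le,
      ← ENNReal.ofReal_mul ha.le, ← ENNReal.ofReal_mul (Real.rpow_nonneg hpos.le _),
      ← ENNReal.ofReal_add (by positivity) (mul_nonneg (Real.rpow_nonneg hpos.le _)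
        ((norm_nonneg _).trans (hC p ⟨Ioo_subset_Icc_self hp.1, hp.2⟩)))]
    refine ENNReal.ofReal_le_ofReal (key.trans ?_)
    rw [mul_assoc, mul_inv, Real.rpow_neg hpos.le]
    rw [Real.rpow_neg (om_pos _).le] at hCp
    gcongr
  refine lt_of_le_of_lt (lintegral_mono_ae hbound) ?_
  rw [lintegral_add_left hm]
  refine ENNReal.add_lt_top.2 ⟨?_, ?_⟩
  · rw [lintegral_prod_symm _ hm.aemeasurable]
    exact lt_of_le_of_lt (lintegral_mono' Measure.restrict_le_self le_rfl) hE
  · rw [lintegral_mul_const' _ _ ENNReal.ofReal_ne_top]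
    refine ENNReal.mul_lt_top ?_ ENNReal.ofReal_lt_top
    have hr := (integrableOn_rpow_Ioo (by linarith : 2 - 2 * μ < 1) hT).lintegral_lt_top
    rw [lintegral_prod _ (by
      exact (measurable_fst.pow_const _).ennreal_ofReal.aemeasurable)]
    simp only [lintegral_const, Measure.restrict_apply MeasurableSet.univ, univ_inter]
    rw [lintegral_mul_const' _ _ hQ.measure_lt_top.ne]
    exact ENNReal.mul_lt_top hr hQ.measure_lt_top

lemma integrable_mul_test (hβ : 0 < β) (hμ : 1 / 2 < μ) (hT : 0 < T)
    {V : ℝ → En n × En n → ℂ} (hV : Measurable fun p : ℝ × (En n × En n) => V p.1 p.2)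
    (hE : ∫⁻ q, energy β s T μ V q < ⊤) {ψ : ℝ × (En n × En n) → ℝ} (hψ : Continuous ψ)
    (hψc : HasCompactSupport ψ) :
    Integrable (fun p : ℝ × (En n × En n) => V p.1 p.2 * (ψ p : ℂ))
      ((volume.restrict (Ioo 0 T)).prod volume) := by
  set Q : Set (En n × En n) := Prod.snd '' tsupport ψ with hQdef
  have hQ : IsCompact Q := hψc.isCompact.image continuous_snd
  have hz : ∀ p, p.2 ∉ Q → ψ p = 0 := fun p hp =>
    image_eq_zero_of_notMem_tsupport fun h => hp ⟨p, h, rfl⟩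
  obtain ⟨C, hC⟩ := hψ.bounded_above_of_compact_support hψc
  have h1 := integrable_of_energy hβ hμ hT hV hE hQ
  have h2 : Integrable (fun p : ℝ × (En n × En n) => V p.1 p.2 * (ψ p : ℂ))
      ((volume.restrict (Ioo 0 T)).prod (volume.restrict Q)) :=
    h1.mul_bdd (c := C) (Complex.continuous_ofReal.comp hψ).aestronglyMeasurable
      (ae_of_all _ fun p => by simpa using hC p)
  rw [← Measure.restrict_univ (μ := volume.restrict (Ioo 0 T)), Measure.prod_restrict] at h2
  refine (integrableOn_iff_integrable_of_support_subset ?_).1 h2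
  intro p hp
  refine ⟨mem_univ _, ?_⟩
  by_contra hq
  exact hp (by simp [hz p hq])

end Integrability

section WeakForm

variable {n : ℕ}

/-- The shear as a homeomorphism of space-time. -/
def spaceTimeShear : (ℝ × (En n × En n)) ≃ₜ (ℝ × (En n × En n)) where
  toFun p := (p.1, shear (-p.1) p.2)
  invFun p := (p.1, shear p.1 p.2)
  left_inv p := by simp
  right_inv p := by simp
  continuous_toFun := by fun_prop
  continuous_invFun := by fun_prop

lemma integral_mul_eq_comoving (U : ℝ → En n → En n → ℂ) (ψ : ℝ × (En n × En n) → ℝ)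
    (ν : Measure ℝ) :
    ∫ t, (∫ q : En n × En n, U t q.1 q.2 * (ψ (t, q) : ℂ)) ∂ν =
      ∫ t, (∫ q : En n × En n, comoving U t q * (ψ (t, shear (-t) q) : ℂ)) ∂ν := by
  refine integral_congr_ae (ae_of_all _ fun t => ?_)
  exact (integral_shear (-t) fun q => U t q.1 q.2 * (ψ (t, q) : ℂ)).symm

lemma hasDerivAt_comp_shear {φ : ℝ × (En n × En n) → ℝ} (hφ : Differentiable ℝ φ) (t : ℝ)
    (q : En n × En n) :
    HasDerivAt (fun τ => φ (τ, shear (-τ) q))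
      (fderiv ℝ φ (t, shear (-t) q) ((1 : ℝ), ((0 : En n), -(shear (-t) q).1))) t := by
  have h1 : HasDerivAt (fun τ : ℝ => q.2 + (-τ) • q.1) (-q.1) t := by
    simpa using (((hasDerivAt_id t).neg.smul_const q.1).const_add q.2)
  have h2 : HasDerivAt (fun τ : ℝ => (τ, shear (-τ) q)) ((1 : ℝ), ((0 : En n), -q.1)) t :=
    (hasDerivAt_id t).prodMk ((hasDerivAt_const t q.1).prodMk h1)
  exact (hφ (t, shear (-t) q)).hasFDerivAt.comp_hasDerivAt t h2

end WeakForm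

section SmoothTransition

lemma hasDerivAt_smoothTransition (x : ℝ) :
    HasDerivAt Real.smoothTransition (deriv Real.smoothTransition x) x :=
  ((Real.smoothTransition.contDiff (n := 1)).differentiable (by simp) x).hasDerivAt

lemma continuous_deriv_smoothTransition : Continuous (deriv Real.smoothTransition) :=
  (Real.smoothTransition.contDiff (n := 1)).continuous_deriv (by simp)

lemma deriv_smoothTransition_of_neg {x : ℝ} (hx : x < 0) : deriv Real.smoothTransition x = 0 := by
  have h : Real.smoothTransition =ᶠ[nhds x] fun _ => (0 : ℝ) := by
    filter_upwards [Iio_mem_nhds hx] with y hy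
    exact Real.smoothTransition.zero_of_nonpos (le_of_lt hy)
  rw [h.deriv_eq, deriv_const]

lemma deriv_smoothTransition_of_one_lt {x : ℝ} (hx : 1 < x) :
    deriv Real.smoothTransition x = 0 := by
  have h : Real.smoothTransition =ᶠ[nhds x] fun _ => (1 : ℝ) := by
    filter_upwards [Ioi_mem_nhds hx] with y hy
    exact Real.smoothTransition.one_of_one_le (le_of_lt hy)
  rw [h.deriv_eq, deriv_const]

lemma exists_bound_deriv_smoothTransition :
    ∃ C : ℝ, 0 < C ∧ ∀ x, |deriv Real.smoothTransition x| ≤ C := by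
  obtain ⟨C, hC⟩ := isCompact_Icc.exists_bound_of_continuousOn (s := Icc (0 : ℝ) 1)
    continuous_deriv_smoothTransition.continuousOn
  refine ⟨max C 1, by positivity, fun x => ?_⟩
  by_cases h0 : x < 0
  · rw [deriv_smoothTransition_of_neg h0, abs_zero]; positivity
  by_cases h1 : 1 < x
  · rw [deriv_smoothTransition_of_one_lt h1, abs_zero]; positivity
  · exact (hC x ⟨not_lt.1 h0, not_lt.1 h1⟩).trans (le_max_left _ _)

end SmoothTransition

section Extension

variable {n : ℕ} {β s T μ : ℝ}

lemma energy_le_of_support (hβ : β ∈ Ioc (0 : ℝ) 2) (hμ1 : μ ≤ 1)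
    {V : ℝ → En n × En n → ℂ} {q : En n × En n} {M : ℝ≥0∞}
    (hsupp : ∀ t, 0 < t → 1 < t * om β q → V t q = 0) (hM : ∀ t, ‖V t q‖ₑ ≤ M) :
    energy β s T μ V q ≤ ENNReal.ofReal (8 ^ |2 * s| * (3 - 2 * μ)⁻¹ *
      om β q ^ (2 * s - (3 - 2 * μ))) * M ^ 2 := by
  have hω := om_pos (β := β) q
  set b : ℝ := (om β q)⁻¹ with hb
  have hb0 : 0 < b := by positivity
  have hpow : ∫⁻ t in Ioc 0 b, ENNReal.ofReal (t ^ (2 - 2 * μ)) =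
      ENNReal.ofReal (b ^ (3 - 2 * μ) / (3 - 2 * μ)) := by
    have h1 := intervalIntegral.intervalIntegrable_rpow' (a := 0) (b := b) (r := 2 - 2 * μ)
      (by linarith)
    have h2 : ∫ t in (0 : ℝ)..b, t ^ (2 - 2 * μ) = b ^ (3 - 2 * μ) / (3 - 2 * μ) := by
      rw [integral_rpow (Or.inl (by linarith)), Real.zero_rpow (by linarith), sub_zero]
      ring_nf
    rw [← h2, intervalIntegral.integral_of_le hb0.le, ofReal_integral_eq_lintegral_ofReal]
    · exact (intervalIntegrable_iff_integrableOn_Ioc_of_le hb0.le).1 h1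
    · filter_upwards [ae_restrict_mem measurableSet_Ioc] with t ht
      exact Real.rpow_nonneg ht.1.le _
  calc energy β s T μ V q ≤ ∫⁻ t in Ioo 0 T, (Ioc 0 b).indicator
        (fun t => ENNReal.ofReal (t ^ (2 - 2 * μ)) *
          (ENNReal.ofReal (8 ^ |2 * s| * om β q ^ (2 * s)) * M ^ 2)) t := by
        refine setLIntegral_mono' measurableSet_Ioo fun t ht => ?_
        by_cases htb : t ≤ b
        · rw [indicator_of_mem (show t ∈ Ioc 0 b from ⟨ht.1, htb⟩)]
          have : |(-t)| * om β q ≤ 1 := by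
            rw [abs_neg, abs_of_pos ht.1]
            rwa [hb, ← one_div, le_div_iff₀ hω] at htb
          gcongr
          · exact om_rpow_shear_le hβ this _
          · exact hM t
        · rw [hsupp t ht.1 (by rwa [not_le, hb, ← one_div, div_lt_iff₀ hω] at htb)]
          simp
    _ ≤ ∫⁻ t, (Ioc 0 b).indicator
        (fun t => ENNReal.ofReal (t ^ (2 - 2 * μ)) *
          (ENNReal.ofReal (8 ^ |2 * s| * om β q ^ (2 * s)) * M ^ 2)) t :=
        setLIntegral_le_lintegral _ _
    _ = _ := by
        rw [lintegral_indicator measurableSet_Ioc, lintegral_mul_const _ (by fun_prop), hpow,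
          ← mul_assoc, ← ENNReal.ofReal_mul
            (div_nonneg (Real.rpow_nonneg hb0.le _) (by linarith))]
        congr 2
        rw [Real.rpow_sub hω, hb, Real.inv_rpow hω.le]
        ring

/-- The Fourier side of an extension of `G` to positive times: transport `G` freely and cut off
after a time of order `1 / ω_β`. -/
def kineticExtend (β : ℝ) (G : En n → En n → ℂ) (t : ℝ) (k ξ : En n) : ℂ :=
  G (shear t (k, ξ)).1 (shear t (k, ξ)).2 *
    (Real.smoothTransition (1 - t * om β (shear t (k, ξ))) : ℂ)

/-- The transport derivative of `kineticExtend β G`. -/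
def kineticExtendDeriv (β : ℝ) (G : En n → En n → ℂ) (t : ℝ) (k ξ : En n) : ℂ :=
  G (shear t (k, ξ)).1 (shear t (k, ξ)).2 *
    ((deriv Real.smoothTransition (1 - t * om β (shear t (k, ξ))) *
      -om β (shear t (k, ξ)) : ℝ) : ℂ)

lemma comoving_extend (G : En n → En n → ℂ) (t : ℝ) (q : En n × En n) :
    comoving (kineticExtend β G) t q =
      G q.1 q.2 * (Real.smoothTransition (1 - t * om β q) : ℂ) := by
  simp [comoving, kineticExtend]

lemma comoving_extendDeriv (G : En n → En n → ℂ) (t : ℝ) (q : En n × En n) :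
    comoving (kineticExtendDeriv β G) t q = G q.1 q.2 *
      ((deriv Real.smoothTransition (1 - t * om β q) * -om β q : ℝ) : ℂ) := by
  simp [comoving, kineticExtendDeriv]

lemma measU_extend (hβ : 0 < β) {G : En n → En n → ℂ}
    (hG : Measurable fun p : En n × En n => G p.1 p.2) : MeasU n (kineticExtend β G) := by
  have h1 : Measurable fun p : ℝ × En n × En n => shear p.1 p.2 := by fun_prop
  have h2 : Measurable fun p : ℝ × En n × En n => om β (shear p.1 p.2) :=
    (continuous_om hβ).measurable.comp h1
  unfold MeasU kineticExtend
  refine (hG.comp h1).mul (Complex.measurable_ofReal.comp ?_)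
  exact Real.smoothTransition.continuous.measurable.comp
    (measurable_const.sub (measurable_fst.mul h2))

lemma measU_extendDeriv (hβ : 0 < β) {G : En n → En n → ℂ}
    (hG : Measurable fun p : En n × En n => G p.1 p.2) : MeasU n (kineticExtendDeriv β G) := by
  have h1 : Measurable fun p : ℝ × En n × En n => shear p.1 p.2 := by fun_prop
  have h2 : Measurable fun p : ℝ × En n × En n => om β (shear p.1 p.2) :=
    (continuous_om hβ).measurable.comp h1
  unfold MeasU kineticExtendDeriv
  refine (hG.comp h1).mul (Complex.measurable_ofReal.comp (Measurable.mul ?_ h2.neg))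
  exact continuous_deriv_smoothTransition.measurable.comp
    (measurable_const.sub (measurable_fst.mul h2))

lemma L2X_extend_le (hβ : β ∈ Ioc (0 : ℝ) 2) (hμ1 : μ ≤ 1) {G : En n → En n → ℂ}
    (hG : Measurable fun p : En n × En n => G p.1 p.2) :
    L2X n β (s + 1) T μ (kineticExtend β G) ≤
      ENNReal.ofReal (8 ^ |2 * (s + 1)| * (3 - 2 * μ)⁻¹) *
        Xnorm n β (s + 1 / 2 - (1 - μ)) G := by
  rw [L2X_eq hβ.1 (measU_extend hβ.1 hG), Xnorm_eq hβ.1 hG,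
    ← lintegral_const_mul' _ _ ENNReal.ofReal_ne_top]
  refine lintegral_mono fun q => ?_
  refine (energy_le_of_support hβ hμ1 (M := ‖G q.1 q.2‖ₑ) ?_ ?_).trans (le_of_eq ?_)
  · intro t ht h
    rw [comoving_extend, Real.smoothTransition.zero_of_nonpos (by linarith)]
    simp
  · intro t
    rw [comoving_extend, enorm_mul]
    refine mul_le_of_le_one_right zero_le ?_
    rw [← ofReal_norm, Complex.norm_real, Real.norm_eq_abs,
      abs_of_nonneg (Real.smoothTransition.nonneg _)]
    exact ENNReal.ofReal_le_one.2 (Real.smoothTransition.le_one _)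
  · rw [← mul_assoc, ← ENNReal.ofReal_mul (mul_nonneg (by positivity)
      (inv_nonneg.2 (by linarith)))]
    ring_nf

lemma L2X_extendDeriv_le (hβ : β ∈ Ioc (0 : ℝ) 2) (hμ1 : μ ≤ 1) {C : ℝ} (hC : 0 < C)
    (hCb : ∀ x, |deriv Real.smoothTransition x| ≤ C) {G : En n → En n → ℂ}
    (hG : Measurable fun p : En n × En n => G p.1 p.2) :
    L2X n β s T μ (kineticExtendDeriv β G) ≤
      ENNReal.ofReal (8 ^ |2 * s| * (3 - 2 * μ)⁻¹ * C ^ 2) *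
        Xnorm n β (s + 1 / 2 - (1 - μ)) G := by
  rw [L2X_eq hβ.1 (measU_extendDeriv hβ.1 hG), Xnorm_eq hβ.1 hG,
    ← lintegral_const_mul' _ _ ENNReal.ofReal_ne_top]
  refine lintegral_mono fun q => ?_
  have hω := om_pos (β := β) q
  have hc : 0 ≤ 8 ^ |2 * s| * (3 - 2 * μ)⁻¹ :=
    mul_nonneg (by positivity) (inv_nonneg.2 (by linarith))
  refine (energy_le_of_support hβ hμ1
    (M := ‖G q.1 q.2‖ₑ * ENNReal.ofReal (C * om β q)) ?_ ?_).trans (le_of_eq ?_)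
  · intro t ht h
    rw [comoving_extendDeriv, deriv_smoothTransition_of_neg (by linarith)]
    simp
  · intro t
    rw [comoving_extendDeriv, enorm_mul]
    gcongr
    rw [← ofReal_norm, Complex.norm_real, Real.norm_eq_abs, abs_mul, abs_neg, abs_of_pos hω]
    exact ENNReal.ofReal_le_ofReal (mul_le_mul_of_nonneg_right (hCb _) hω.le)
  · rw [mul_pow, ← mul_assoc, ← mul_assoc, ← ENNReal.ofReal_pow (by positivity), mul_right_comm,
      ← ENNReal.ofReal_mul (by positivity), ← ENNReal.ofReal_mul (by positivity)]
    congr 2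
    rw [show 2 * (s + 1 / 2 - (1 - μ)) = 2 * s - (3 - 2 * μ) + (2 : ℕ) by push_cast; ring,
      Real.rpow_add_natCast hω.ne']
    ring

lemma isFTransportDeriv_extend (hβ : β ∈ Ioc (0 : ℝ) 2) (hμ : 1 / 2 < μ) (hT : 0 < T)
    {G : En n → En n → ℂ} (hG : Measurable fun p : En n × En n => G p.1 p.2)
    (hU : L2X n β s T μ (kineticExtend β G) < ⊤) (hH : L2X n β s T μ (kineticExtendDeriv β G) < ⊤) :
    IsFTransportDeriv n T (kineticExtend β G) (kineticExtendDeriv β G) := by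
  intro φ hφ hφc hφ0
  have hφd : Differentiable ℝ φ := hφ.differentiable (by simp)
  set ψ : ℝ × (En n × En n) → ℝ := fun p => fderiv ℝ φ p ((1 : ℝ), ((0 : En n), -p.2.1))
    with hψdef
  have hψ : Continuous ψ := (hφ.continuous_fderiv (by simp)).clm_apply (by fun_prop)
  have hψc : HasCompactSupport ψ := by
    refine (hφc.fderiv (𝕜 := ℝ)).mono fun p hp h => hp ?_
    simp only [hψdef]
    rw [h]; simp
  have hUm := measU_extend hβ.1 hG
  have hHm := measU_extendDeriv hβ.1 hG
  rw [L2X_eq hβ.1 hUm] at hU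
  rw [L2X_eq hβ.1 hHm] at hH
  have hI1 := integrable_mul_test hβ.1 hμ hT (measurable_comoving hUm) hU
    (hψ.comp spaceTimeShear.continuous) (hψc.comp_homeomorph spaceTimeShear)
  have hI2 := integrable_mul_test hβ.1 hμ hT (measurable_comoving hHm) hH
    (hφ.continuous.comp spaceTimeShear.continuous) (hφc.comp_homeomorph spaceTimeShear)
  have e1 := integral_mul_eq_comoving (kineticExtend β G) ψ (volume.restrict (Ioo 0 T))
  have e2 := integral_mul_eq_comoving (kineticExtendDeriv β G) φ (volume.restrict (Ioo 0 T))
  rw [e2]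
  refine (congrArg Neg.neg e1).trans ?_
  rw [integral_integral_swap (f := fun t q => comoving (kineticExtend β G) t q *
      (ψ (t, shear (-t) q) : ℂ)) hI1,
    integral_integral_swap (f := fun t q => comoving (kineticExtendDeriv β G) t q *
      (φ (t, shear (-t) q) : ℂ)) hI2, ← integral_neg]
  refine integral_congr_ae (ae_of_all _ fun q => ?_)
  simp only
  rw [← integral_Ioc_eq_integral_Ioo, ← integral_Ioc_eq_integral_Ioo,
    ← intervalIntegral.integral_of_le hT.le, ← intervalIntegral.integral_of_le hT.le]
  have hu (t : ℝ) : HasDerivAt (fun t => comoving (kineticExtend β G) t q)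
      (comoving (kineticExtendDeriv β G) t q) t := by
    simp only [comoving_extend, comoving_extendDeriv]
    refine HasDerivAt.const_mul _ (HasDerivAt.ofReal_comp ?_)
    refine (hasDerivAt_smoothTransition _).comp t ?_
    simpa using ((hasDerivAt_id t).mul_const (om β q)).const_sub 1
  have hv (t : ℝ) : HasDerivAt (fun t => (φ (t, shear (-t) q) : ℂ))
      (ψ (t, shear (-t) q) : ℂ) t := (hasDerivAt_comp_shear hφd t q).ofReal_comp
  have hu' : Continuous fun t => comoving (kineticExtendDeriv β G) t q := by
    simp only [comoving_extendDeriv]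
    refine continuous_const.mul (Complex.continuous_ofReal.comp (Continuous.mul ?_
      continuous_const))
    exact continuous_deriv_smoothTransition.comp (by fun_prop)
  have hv' : Continuous fun t : ℝ => (ψ (t, shear (-t) q) : ℂ) :=
    Complex.continuous_ofReal.comp (hψ.comp (by fun_prop))
  rw [intervalIntegral.integral_mul_deriv_eq_deriv_mul (fun t _ => hu t) (fun t _ => hv t)
    (hu'.intervalIntegrable _ _) (hv'.intervalIntegrable _ _),
    hφ0 (T, shear (-T) q) (by simp), hφ0 (0, shear (-0) q) (by simp)]
  simp

lemma hasTrace_extend (hβ : 0 < β) {G : En n → En n → ℂ}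
    (hG : Measurable fun p : En n × En n => G p.1 p.2) (hfin : Hm1 n G < ⊤) :
    HasTrace n T (kineticExtend β G) G := by
  rw [Hm1_eq hG] at hfin
  set m : ℝ → En n × En n → ℂ := fun t q =>
    G q.1 q.2 * ((Real.smoothTransition (1 - t * om β q) - 1 : ℝ) : ℂ) with hm
  have hmm (t : ℝ) : Measurable (m t) := by
    refine hG.mul (Complex.measurable_ofReal.comp (Measurable.sub ?_ measurable_const))
    exact Real.smoothTransition.continuous.measurable.comp
      (measurable_const.sub (measurable_const.mul (continuous_om hβ).measurable))
  have h1 := tendsto_hWeight_shear_sub hG hfin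
  have h2 : Tendsto (fun t : ℝ => ∫⁻ q, ENNReal.ofReal (hWeight q) * ‖m t q‖ₑ ^ 2)
      (nhds 0) (nhds 0) := by
    have hz : ∫⁻ q : En n × En n, (0 : ℝ≥0∞) = 0 := by simp
    rw [← hz]
    refine tendsto_lintegral_filter_of_dominated_convergence
      (fun q => ENNReal.ofReal (hWeight q) * ‖G q.1 q.2‖ₑ ^ 2) ?_ ?_ hfin.ne ?_
    · exact Eventually.of_forall fun t =>
        continuous_hWeight.measurable.ennreal_ofReal.mul ((hmm t).enorm.pow_const 2)
    · refine Eventually.of_forall fun t => ae_of_all _ fun q => ?_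
      gcongr
      simp only [hm]
      rw [enorm_mul]
      refine mul_le_of_le_one_right zero_le ?_
      rw [← ofReal_norm, Complex.norm_real, Real.norm_eq_abs]
      refine ENNReal.ofReal_le_one.2 (abs_le.2 ⟨?_, ?_⟩)
      · linarith [Real.smoothTransition.nonneg (1 - t * om β q)]
      · linarith [Real.smoothTransition.le_one (1 - t * om β q)]
    · refine ae_of_all _ fun q => ?_
      have hc : Continuous fun t : ℝ => m t q := by
        refine continuous_const.mul (Complex.continuous_ofReal.comp
          (Continuous.sub ?_ continuous_const))
        exact Real.smoothTransition.continuous.comp (by fun_prop)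
      have h3 := ENNReal.Tendsto.const_mul (a := ENNReal.ofReal (hWeight q))
        (ENNReal.Tendsto.pow (n := 2) ((hc.enorm).tendsto 0)) (Or.inr ENNReal.ofReal_ne_top)
      simpa [hm] using h3
  have h3 := ENNReal.Tendsto.const_mul (a := 4)
    ((ENNReal.Tendsto.const_mul (a := 3) h2 (Or.inr (by norm_num))).add h1) (Or.inr (by norm_num))
  rw [mul_zero, add_zero, mul_zero] at h3
  refine tendsto_of_tendsto_of_tendsto_of_le_of_le' tendsto_const_nhds
    (h3.mono_left nhdsWithin_le_nhds) (Eventually.of_forall fun _ => zero_le) ?_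
  filter_upwards [nhdsWithin_le_nhds (Metric.ball_mem_nhds (0 : ℝ) one_pos)] with t ht
  have ht' : |-t| ≤ 1 := by rw [abs_neg]; simpa using (mem_ball_zero_iff.1 ht).le
  rw [Hm1_eq (((measU_extend hβ hG).apply t).sub hG)]
  have h4 : ∫⁻ q, ENNReal.ofReal (hWeight q) * ‖m t (shear t q)‖ₑ ^ 2 ≤
      3 * ∫⁻ q, ENNReal.ofReal (hWeight q) * ‖m t q‖ₑ ^ 2 := by
    rw [← lintegral_shear (-t), ← lintegral_const_mul' _ _ (by norm_num)]
    refine lintegral_mono fun q => ?_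
    rw [shear_shear_neg, ← mul_assoc]
    gcongr
    rw [show (3 : ℝ≥0∞) = ENNReal.ofReal 3 by norm_num, ← ENNReal.ofReal_mul (by norm_num)]
    exact ENNReal.ofReal_le_ofReal (hWeight_shear_le ht' q)
  refine le_trans ?_ (mul_le_mul_right (add_le_add_left h4 _) _)
  have h5 : Measurable fun q : En n × En n =>
      ENNReal.ofReal (hWeight q) * ‖m t (shear t q)‖ₑ ^ 2 :=
    continuous_hWeight.measurable.ennreal_ofReal.mul
      (((hmm t).comp (by fun_prop : Measurable (shear t))).enorm.pow_const 2)
  rw [← lintegral_add_left h5, ← lintegral_const_mul' _ _ (by norm_num)]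
  refine lintegral_mono fun q => ?_
  rw [← mul_add, mul_left_comm]
  gcongr
  refine le_trans (le_of_eq ?_) (enorm_add_sq_le_four _ _)
  congr 2
  simp only [hm, kineticExtend]
  push_cast
  ring

lemma exists_extension (n : ℕ) (hβ : β ∈ Ioc (0 : ℝ) 2) (hμ : μ ∈ Ioc (1 / 2 : ℝ) 1)
    (hs : -(1 / 2 : ℝ) ≤ s) (hT : 0 < T) :
    ∃ C : ℝ, 0 < C ∧ ∀ G : En n → En n → ℂ, Measurable (fun p : En n × En n => G p.1 p.2) →
      Xnorm n β (s + 1 / 2 - (1 - μ)) G < ⊤ →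
      ∃ U H : ℝ → En n → En n → ℂ, SolSpace n β s T μ U H ∧ HasTrace n T U G ∧
        L2X n β s T μ U ^ ((1 : ℝ) / 2) + L2X n β s T μ H ^ ((1 : ℝ) / 2) +
          L2X n β (s + 1) T μ U ^ ((1 : ℝ) / 2) ≤
        ENNReal.ofReal C * Xnorm n β (s + 1 / 2 - (1 - μ)) G ^ ((1 : ℝ) / 2) := by
  obtain ⟨C, hC, hCb⟩ := exists_bound_deriv_smoothTransition
  have h3 : 0 < 3 - 2 * μ := by linarith [hμ.2]
  set c1 : ℝ := 8 ^ |2 * (s + 1)| * (3 - 2 * μ)⁻¹ with hc1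
  set c2 : ℝ := 8 ^ |2 * s| * (3 - 2 * μ)⁻¹ * C ^ 2 with hc2
  have hc1p : 0 < c1 := by positivity
  have hc2p : 0 < c2 := by positivity
  refine ⟨c1 ^ ((1 : ℝ) / 2) + c2 ^ ((1 : ℝ) / 2) + c1 ^ ((1 : ℝ) / 2), by positivity,
    fun G hG hfin => ⟨kineticExtend β G, kineticExtendDeriv β G, ?_⟩⟩
  have hUm := measU_extend hβ.1 hG
  have hU1 := L2X_extend_le (s := s) (T := T) hβ hμ.2 hG
  have hH := L2X_extendDeriv_le (s := s) (T := T) hβ hμ.2 hC hCb hG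
  have hU0 : L2X n β s T μ (kineticExtend β G) ≤ L2X n β (s + 1) T μ (kineticExtend β G) := by
    rw [L2X_eq hβ.1 hUm, L2X_eq hβ.1 hUm]
    exact lintegral_mono fun q => energy_mono_exponent (by linarith) q
  have fU1 := hU1.trans_lt (ENNReal.mul_lt_top ENNReal.ofReal_lt_top hfin)
  have fH := hH.trans_lt (ENNReal.mul_lt_top ENNReal.ofReal_lt_top hfin)
  have fU0 := hU0.trans_lt fU1
  refine ⟨⟨hUm, measU_extendDeriv hβ.1 hG, isFTransportDeriv_extend hβ hμ.1 hT hG fU0 fH, fU0,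
    fH, fU1⟩, hasTrace_extend hβ.1 hG ?_, ?_⟩
  · exact (Hm1_le_Xnorm hβ (by linarith [hμ.1]) hG).trans_lt
      (ENNReal.mul_lt_top (by norm_num) hfin)
  · have hroot {a x : ℝ≥0∞} {c : ℝ} (hc : 0 < c) (h : a ≤ ENNReal.ofReal c * x) :
        a ^ ((1 : ℝ) / 2) ≤ ENNReal.ofReal (c ^ ((1 : ℝ) / 2)) * x ^ ((1 : ℝ) / 2) := by
      rw [← ENNReal.ofReal_rpow_of_pos hc, ← ENNReal.mul_rpow_of_nonneg _ _ (by norm_num)]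
      exact ENNReal.rpow_le_rpow h (by norm_num)
    rw [ENNReal.ofReal_add (by positivity) (by positivity),
      ENNReal.ofReal_add (by positivity) (by positivity), add_mul, add_mul]
    exact add_le_add (add_le_add (hroot hc1p (hU0.trans hU1)) (hroot hc2p hH)) (hroot hc1p hU1)

end Extension

section FiberEquation

variable {n : ℕ} {β s T μ : ℝ}

lemma ae_integrable_of_energy (hβ : 0 < β) (hμ : 1 / 2 < μ) (hT : 0 < T)
    {V : ℝ → En n × En n → ℂ} (hV : Measurable fun p : ℝ × (En n × En n) => V p.1 p.2)
    (hE : ∫⁻ q, energy β s T μ V q < ⊤) :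
    ∀ᵐ q, Integrable (fun t => V t q) (volume.restrict (Ioo 0 T)) := by
  have h (N : ℕ) : ∀ᵐ q : En n × En n, q ∈ Metric.closedBall (0 : En n × En n) N →
      Integrable (fun t => V t q) (volume.restrict (Ioo 0 T)) :=
    (ae_restrict_iff' measurableSet_closedBall).1
      (integrable_of_energy hβ hμ hT hV hE (isCompact_closedBall 0 (N : ℝ))).prod_left_ae
  filter_upwards [ae_all_iff.2 h] with q hq
  obtain ⟨N, hN⟩ := exists_nat_ge ‖q‖
  exact hq N (by simpa using hN)

lemma integrable_mul_time (hβ : 0 < β) (hμ : 1 / 2 < μ) (hT : 0 < T)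
    {V : ℝ → En n × En n → ℂ} (hV : Measurable fun p : ℝ × (En n × En n) => V p.1 p.2)
    (hE : ∫⁻ q, energy β s T μ V q < ⊤) {f : ℝ → ℝ} (hf : Continuous f)
    (hfc : HasCompactSupport f) {Q : Set (En n × En n)} (hQ : IsCompact Q) :
    Integrable (fun p : ℝ × (En n × En n) => V p.1 p.2 * (f p.1 : ℂ))
      ((volume.restrict (Ioo 0 T)).prod (volume.restrict Q)) := by
  obtain ⟨C, hC⟩ := hf.bounded_above_of_compact_support hfc
  exact (integrable_of_energy hβ hμ hT hV hE hQ).mul_bdd (c := C)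
    (Complex.continuous_ofReal.comp (hf.comp continuous_fst)).aestronglyMeasurable
    (ae_of_all _ fun p => by simpa using hC p.1)

lemma HasCompactSupport.mul_prod {X Y : Type*} [TopologicalSpace X] [TopologicalSpace Y]
    [R1Space X] [R1Space Y] {f : X → ℝ} {g : Y → ℝ}
    (hf : HasCompactSupport f) (hg : HasCompactSupport g) :
    HasCompactSupport fun p : X × Y => f p.1 * g p.2 := by
  refine HasCompactSupport.intro (hf.isCompact.prod hg.isCompact) fun p hp => ?_
  rcases not_and_or.1 hp with h | h
  · rw [image_eq_zero_of_notMem_tsupport h, zero_mul]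
  · rw [image_eq_zero_of_notMem_tsupport h, mul_zero]

lemma ae_integral_comoving_eq_zero (hβ : 0 < β) (hμ : 1 / 2 < μ) (hT : 0 < T)
    {U H : ℝ → En n → En n → ℂ} (hS : SolSpace n β s T μ U H) {f : ℝ → ℝ}
    (hf : ContDiff ℝ ((⊤ : ℕ∞) : WithTop ℕ∞) f) (hf0 : ∀ t, t ∉ Ioo 0 T → f t = 0) :
    ∀ᵐ q, ∫ t in Ioo 0 T,
      (comoving U t q * ((deriv f t : ℝ) : ℂ) + comoving H t q * (f t : ℂ)) = 0 := by
  obtain ⟨hU, hH, hw, hU2, hH2, -⟩ := hS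
  rw [L2X_eq hβ hU] at hU2
  rw [L2X_eq hβ hH] at hH2
  have hVm := measurable_comoving hU
  have hKm := measurable_comoving hH
  have hfc : HasCompactSupport f :=
    HasCompactSupport.intro (isCompact_Icc (a := 0) (b := T)) fun t ht =>
      hf0 t fun h => ht (Ioo_subset_Icc_self h)
  have hf'c : HasCompactSupport (deriv f) := hfc.deriv
  have hf' : Continuous (deriv f) := hf.continuous_deriv (by simp)
  have hloc : LocallyIntegrable (fun q : En n × En n => ∫ t in Ioo 0 T,
      (comoving U t q * ((deriv f t : ℝ) : ℂ) + comoving H t q * (f t : ℂ))) volume := by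
    refine locallyIntegrable_iff.2 fun Q hQ => ?_
    exact ((integrable_mul_time hβ hμ hT hVm hU2 hf' hf'c hQ).add
      (integrable_mul_time hβ hμ hT hKm hH2 hf.continuous hfc hQ)).integral_prod_right
  refine ae_eq_zero_of_integral_contDiff_smul_eq_zero hloc fun ψ hψ hψc => ?_
  have hI1 := integrable_mul_test hβ hμ hT hVm hU2 (ψ := fun p => deriv f p.1 * ψ p.2)
    (by have := hψ.continuous; fun_prop) (hf'c.mul_prod hψc)
  have hI2 := integrable_mul_test hβ hμ hT hKm hH2 (ψ := fun p => f p.1 * ψ p.2)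
    (by have := hψ.continuous; have := hf.continuous; fun_prop) (hfc.mul_prod hψc)
  set φ : ℝ × (En n × En n) → ℝ := fun p => f p.1 * ψ (shear p.1 p.2) with hφdef
  have hφ : ContDiff ℝ ((⊤ : ℕ∞) : WithTop ℕ∞) φ :=
    (hf.comp contDiff_fst).mul (hψ.comp (contDiff_shear contDiff_fst contDiff_snd))
  have hφc : HasCompactSupport φ :=
    (hfc.mul_prod hψc).comp_homeomorph spaceTimeShear.symm
  have hφd : Differentiable ℝ φ := hφ.differentiable (by simp)
  have key := hw φ hφ hφc fun p hp => by simp only [hφdef, hf0 _ hp, zero_mul]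
  have hder (t : ℝ) (q : En n × En n) :
      fderiv ℝ φ (t, shear (-t) q) ((1 : ℝ), ((0 : En n), -(shear (-t) q).1)) =
        deriv f t * ψ q := by
    refine (hasDerivAt_comp_shear hφd t q).unique ?_
    simp only [hφdef, shear_shear_neg]
    exact ((hf.differentiable (by simp) t).hasDerivAt).mul_const _
  have e1 := integral_mul_eq_comoving U
    (fun p => fderiv ℝ φ p ((1 : ℝ), ((0 : En n), -p.2.1))) (volume.restrict (Ioo 0 T))
  have e2 := integral_mul_eq_comoving H φ (volume.restrict (Ioo 0 T))
  simp only [hder] at e1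
  simp only [hφdef, shear_shear_neg] at e2 key
  rw [e2] at key
  have key2 := (congrArg Neg.neg e1).symm.trans key
  have hswap := integral_integral_swap (f := fun t q => comoving U t q *
      ((deriv f t * ψ q : ℝ) : ℂ) + comoving H t q * ((f t * ψ q : ℝ) : ℂ)) (hI1.add hI2)
  have hadd := integral_add hI1.integral_prod_left hI2.integral_prod_left
  have hae : ∀ᵐ t ∂(volume.restrict (Ioo 0 T)),
      (∫ q, comoving U t q * ((deriv f t * ψ q : ℝ) : ℂ)) +
        (∫ q, comoving H t q * ((f t * ψ q : ℝ) : ℂ)) =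
      ∫ q, (comoving U t q * ((deriv f t * ψ q : ℝ) : ℂ) +
        comoving H t q * ((f t * ψ q : ℝ) : ℂ)) := by
    filter_upwards [hI1.prod_right_ae, hI2.prod_right_ae] with t h1 h2
    exact (integral_add h1 h2).symm
  calc ∫ q, ψ q • ∫ t in Ioo 0 T,
        (comoving U t q * ((deriv f t : ℝ) : ℂ) + comoving H t q * (f t : ℂ))
      = ∫ q, ∫ t in Ioo 0 T, (comoving U t q * ((deriv f t * ψ q : ℝ) : ℂ) +
        comoving H t q * ((f t * ψ q : ℝ) : ℂ)) := by
        refine integral_congr_ae (ae_of_all _ fun q => ?_)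
        simp only
        rw [← integral_smul]
        refine integral_congr_ae (ae_of_all _ fun t => ?_)
        simp only [Complex.real_smul]
        push_cast
        ring
    _ = 0 := by
        rw [← hswap, ← integral_congr_ae hae, hadd, ← key2, add_neg_cancel]

end FiberEquation

section Ramp

/-- A smooth step rising from `0` at `ε / 2` to `1` at `ε`. -/
def ramp (ε t : ℝ) : ℝ := Real.smoothTransition (2 / ε * t - 1)

variable {ε δ t : ℝ}

lemma contDiff_ramp (ε : ℝ) : ContDiff ℝ ((⊤ : ℕ∞) : WithTop ℕ∞) (ramp ε) :=
  Real.smoothTransition.contDiff.comp (by fun_prop)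

lemma ramp_of_nonpos (hε : 0 < ε) (ht : t ≤ 0) : ramp ε t = 0 := by
  refine Real.smoothTransition.zero_of_nonpos ?_
  have : 2 / ε * t ≤ 0 := mul_nonpos_of_nonneg_of_nonpos (by positivity) ht
  linarith

lemma ramp_of_le (hε : 0 < ε) (ht : ε ≤ t) : ramp ε t = 1 := by
  refine Real.smoothTransition.one_of_one_le ?_
  have : 2 / ε * ε ≤ 2 / ε * t := by gcongr
  rw [div_mul_cancel₀ _ hε.ne'] at this
  linarith

lemma deriv_ramp (ε t : ℝ) :
    deriv (ramp ε) t = deriv Real.smoothTransition (2 / ε * t - 1) * (2 / ε) := by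
  refine HasDerivAt.deriv ((hasDerivAt_smoothTransition _).comp t ?_)
  simpa using ((hasDerivAt_id t).const_mul (2 / ε)).sub_const 1

lemma deriv_ramp_of_lt (hε : 0 < ε) (ht : ε < t) : deriv (ramp ε) t = 0 := by
  rw [deriv_ramp, deriv_smoothTransition_of_one_lt, zero_mul]
  have : 2 / ε * ε < 2 / ε * t := by gcongr
  rw [div_mul_cancel₀ _ hε.ne'] at this
  linarith

lemma continuous_deriv_ramp (ε : ℝ) : Continuous (deriv (ramp ε)) :=
  (contDiff_ramp ε).continuous_deriv (by simp)

lemma abs_deriv_ramp_le {C : ℝ} (hC : ∀ x, |deriv Real.smoothTransition x| ≤ C) (hε : 0 < ε)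
    (t : ℝ) : |deriv (ramp ε) t| ≤ 2 * C / ε := by
  rw [deriv_ramp, abs_mul, abs_of_pos (by positivity : 0 < 2 / ε), mul_comm 2 C, mul_div_assoc]
  gcongr
  exact hC _

lemma abs_ramp_sub_le (ε δ t : ℝ) : |ramp ε t - ramp δ t| ≤ 1 := by
  have h1 := Real.smoothTransition.nonneg (2 / ε * t - 1)
  have h2 := Real.smoothTransition.le_one (2 / ε * t - 1)
  have h3 := Real.smoothTransition.nonneg (2 / δ * t - 1)
  have h4 := Real.smoothTransition.le_one (2 / δ * t - 1)
  unfold ramp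
  exact abs_le.2 ⟨by linarith, by linarith⟩

lemma integral_deriv_ramp {T : ℝ} (hε : 0 < ε) (hεT : ε ≤ T) :
    ∫ t in Ioo 0 T, ((deriv (ramp ε) t : ℝ) : ℂ) = 1 := by
  rw [← integral_Ioc_eq_integral_Ioo,
    ← intervalIntegral.integral_of_le (hε.le.trans hεT), intervalIntegral.integral_ofReal,
    intervalIntegral.integral_deriv_eq_sub
      (fun t _ => (contDiff_ramp ε).differentiable (by simp) t)
      ((continuous_deriv_ramp ε).intervalIntegrable _ _),
    ramp_of_le hε hεT, ramp_of_nonpos hε le_rfl]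
  simp

end Ramp

section FiberBound

variable {n : ℕ} {β s T μ : ℝ}

lemma sq_lintegral_le (hμ : 1 / 2 < μ) {δ : ℝ} (hδ : 0 < δ) {w : ℝ → ℝ≥0∞} (hw : Measurable w) :
    (∫⁻ t in Ioo 0 T ∩ Iic δ, w t) ^ 2 ≤ ENNReal.ofReal (δ ^ (2 * μ - 1) / (2 * μ - 1)) *
      ∫⁻ t in Ioo 0 T ∩ Iic δ, ENNReal.ofReal (t ^ (2 - 2 * μ)) * w t ^ 2 := by
  have hS : MeasurableSet (Ioo 0 T ∩ Iic δ) := measurableSet_Ioo.inter measurableSet_Iic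
  have hpow : ∫⁻ t in Ioc 0 δ, ENNReal.ofReal (t ^ (2 * μ - 2)) =
      ENNReal.ofReal (δ ^ (2 * μ - 1) / (2 * μ - 1)) := by
    have h1 := intervalIntegral.intervalIntegrable_rpow' (a := 0) (b := δ) (r := 2 * μ - 2)
      (by linarith)
    have h2 : ∫ t in (0 : ℝ)..δ, t ^ (2 * μ - 2) = δ ^ (2 * μ - 1) / (2 * μ - 1) := by
      rw [integral_rpow (Or.inl (by linarith)), Real.zero_rpow (by linarith), sub_zero]
      ring_nf
    rw [← h2, intervalIntegral.integral_of_le hδ.le, ofReal_integral_eq_lintegral_ofReal]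
    · exact (intervalIntegrable_iff_integrableOn_Ioc_of_le hδ.le).1 h1
    · filter_upwards [ae_restrict_mem measurableSet_Ioc] with t ht
      exact Real.rpow_nonneg ht.1.le _
  have hH := ENNReal.lintegral_mul_le_Lp_mul_Lq (volume.restrict (Ioo 0 T ∩ Iic δ))
    Real.HolderConjugate.two_two
    (f := fun t => ENNReal.ofReal (t ^ (μ - 1))) (g := fun t => ENNReal.ofReal (t ^ (1 - μ)) * w t)
    (by fun_prop) (by fun_prop)
  have hsq := pow_le_pow_left₀ zero_le hH 2
  have hr (x : ℝ≥0∞) : (x ^ ((1 : ℝ) / 2)) ^ 2 = x := by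
    rw [← ENNReal.rpow_natCast, ← ENNReal.rpow_mul]; norm_num
  rw [mul_pow, hr, hr] at hsq
  have e1 : ∫⁻ t in Ioo 0 T ∩ Iic δ, ((fun t => ENNReal.ofReal (t ^ (μ - 1))) *
      fun t => ENNReal.ofReal (t ^ (1 - μ)) * w t) t = ∫⁻ t in Ioo 0 T ∩ Iic δ, w t := by
    refine setLIntegral_congr_fun hS fun t ht => ?_
    simp only [Pi.mul_apply]
    rw [← mul_assoc, ← ENNReal.ofReal_mul (Real.rpow_nonneg ht.1.1.le _),
      ← Real.rpow_add ht.1.1]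
    simp
  have e2 : ∫⁻ t in Ioo 0 T ∩ Iic δ, ENNReal.ofReal (t ^ (μ - 1)) ^ (2 : ℝ) ≤
      ENNReal.ofReal (δ ^ (2 * μ - 1) / (2 * μ - 1)) := by
    rw [← hpow]
    refine le_trans (le_of_eq (setLIntegral_congr_fun hS fun t ht => ?_))
      (lintegral_mono_set fun t ht => ⟨ht.1.1, ht.2⟩)
    rw [ENNReal.ofReal_rpow_of_nonneg (Real.rpow_nonneg ht.1.1.le _) (by norm_num),
      ← Real.rpow_mul ht.1.1.le]
    ring_nf
  have e3 : ∫⁻ t in Ioo 0 T ∩ Iic δ, (ENNReal.ofReal (t ^ (1 - μ)) * w t) ^ (2 : ℝ) =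
      ∫⁻ t in Ioo 0 T ∩ Iic δ, ENNReal.ofReal (t ^ (2 - 2 * μ)) * w t ^ 2 := by
    refine setLIntegral_congr_fun hS fun t ht => ?_
    rw [ENNReal.mul_rpow_of_nonneg _ _ (by norm_num), ENNReal.rpow_ofNat (w t),
      ENNReal.ofReal_rpow_of_nonneg (Real.rpow_nonneg ht.1.1.le _) (by norm_num),
      ← Real.rpow_mul ht.1.1.le]
    ring_nf
  rw [e1, e3] at hsq
  exact hsq.trans (mul_le_mul_left e2 _)

lemma sq_lintegral_le_energy (hβ : β ∈ Ioc (0 : ℝ) 2) (hμ : 1 / 2 < μ)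
    {V : ℝ → En n × En n → ℂ} {q : En n × En n} (hV : Measurable fun t => V t q)
    {δ : ℝ} (hδ : 0 < δ) (hδq : δ * om β q ≤ 1) :
    ENNReal.ofReal (om β q ^ (2 * s)) * (∫⁻ t in Ioo 0 T ∩ Iic δ, ‖V t q‖ₑ) ^ 2 ≤
      ENNReal.ofReal (δ ^ (2 * μ - 1) / (2 * μ - 1) * 8 ^ |2 * s|) * energy β s T μ V q := by
  have hpos : 0 ≤ δ ^ (2 * μ - 1) / (2 * μ - 1) :=
    div_nonneg (Real.rpow_nonneg hδ.le _) (by linarith)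
  rw [ENNReal.ofReal_mul hpos]
  refine (mul_le_mul_right (sq_lintegral_le hμ hδ hV.enorm) _).trans ?_
  rw [mul_left_comm, mul_assoc]
  refine mul_le_mul_right ?_ _
  rw [← lintegral_const_mul' _ _ ENNReal.ofReal_ne_top]
  unfold energy
  rw [← lintegral_const_mul' _ _ ENNReal.ofReal_ne_top]
  refine le_trans (setLIntegral_mono' (measurableSet_Ioo.inter measurableSet_Iic) fun t ht => ?_)
    (lintegral_mono_set inter_subset_left)
  have : |(-t)| * om β q ≤ 1 := by
    rw [abs_neg, abs_of_pos ht.1.1]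
    exact (mul_le_mul_of_nonneg_right ht.2 (om_pos q).le).trans hδq
  rw [mul_left_comm, mul_left_comm (ENNReal.ofReal (8 ^ |2 * s|)), ← mul_assoc
    (ENNReal.ofReal (8 ^ |2 * s|)), ← ENNReal.ofReal_mul (by positivity)]
  gcongr
  exact om_rpow_le_shear hβ this _

lemma enorm_integral_mul_deriv_ramp_le {C : ℝ}
    (hC : ∀ x, |deriv Real.smoothTransition x| ≤ C) {ε : ℝ} (hε : 0 < ε) (v : ℝ → ℂ) :
    ‖∫ t in Ioo 0 T, v t * ((deriv (ramp ε) t : ℝ) : ℂ)‖ₑ ≤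
      ENNReal.ofReal (2 * C / ε) * ∫⁻ t in Ioo 0 T ∩ Iic ε, ‖v t‖ₑ := by
  refine (enorm_integral_le_lintegral_enorm _).trans ?_
  rw [← lintegral_const_mul' _ _ ENNReal.ofReal_ne_top, inter_comm,
    ← setLIntegral_indicator measurableSet_Iic]
  refine lintegral_mono fun t => ?_
  by_cases ht : t ≤ ε
  · rw [indicator_of_mem (show t ∈ Iic ε from ht), enorm_mul, mul_comm]
    gcongr
    rw [← ofReal_norm, Complex.norm_real, Real.norm_eq_abs]
    exact ENNReal.ofReal_le_ofReal (abs_deriv_ramp_le hC hε t)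
  · rw [deriv_ramp_of_lt hε (not_le.1 ht)]
    simp

lemma enorm_integral_mul_ramp_sub_le {ε δ : ℝ} (hε : 0 < ε) (hεδ : ε ≤ δ) (v : ℝ → ℂ) :
    ‖∫ t in Ioo 0 T, v t * ((ramp ε t - ramp δ t : ℝ) : ℂ)‖ₑ ≤
      ∫⁻ t in Ioo 0 T ∩ Iic δ, ‖v t‖ₑ := by
  refine (enorm_integral_le_lintegral_enorm _).trans ?_
  rw [inter_comm, ← setLIntegral_indicator measurableSet_Iic]
  refine lintegral_mono fun t => ?_
  by_cases ht : t ≤ δ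
  · rw [indicator_of_mem (show t ∈ Iic δ from ht), enorm_mul]
    refine mul_le_of_le_one_right zero_le ?_
    rw [← ofReal_norm, Complex.norm_real, Real.norm_eq_abs]
    exact ENNReal.ofReal_le_one.2 (abs_ramp_sub_le ε δ t)
  · rw [ramp_of_le hε (hεδ.trans (not_le.1 ht).le), ramp_of_le (hε.trans_le hεδ) (not_le.1 ht).le]
    simp

lemma ae_enorm_integral_deriv_ramp_le (hβ : 0 < β) (hμ : 1 / 2 < μ) (hT : 0 < T) {C : ℝ}
    (hC : ∀ x, |deriv Real.smoothTransition x| ≤ C)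
    {U H : ℝ → En n → En n → ℂ} (hS : SolSpace n β s T μ U H) {ε δ : ℝ} (hε : 0 < ε)
    (hεδ : ε ≤ δ) (hδT : δ ≤ T) :
    ∀ᵐ q, ‖∫ t in Ioo 0 T, comoving U t q * ((deriv (ramp ε) t : ℝ) : ℂ)‖ₑ ≤
      ENNReal.ofReal (2 * C / δ) * (∫⁻ t in Ioo 0 T ∩ Iic δ, ‖comoving U t q‖ₑ) +
        ∫⁻ t in Ioo 0 T ∩ Iic δ, ‖comoving H t q‖ₑ := by
  have hδ := hε.trans_le hεδ
  have hU2 := hS.2.2.2.1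
  have hH2 := hS.2.2.2.2.1
  rw [L2X_eq hβ hS.1] at hU2
  rw [L2X_eq hβ hS.2.1] at hH2
  have hf0 (t : ℝ) (ht : t ∉ Ioo 0 T) : ramp ε t - ramp δ t = 0 := by
    rcases le_or_gt t 0 with h | h
    · rw [ramp_of_nonpos hε h, ramp_of_nonpos hδ h, sub_zero]
    · have hTt : T ≤ t := not_lt.1 fun h' => ht ⟨h, h'⟩
      rw [ramp_of_le hε (hεδ.trans (hδT.trans hTt)), ramp_of_le hδ (hδT.trans hTt), sub_self]
  filter_upwards [ae_integral_comoving_eq_zero hβ hμ hT hS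
      ((contDiff_ramp ε).sub (contDiff_ramp δ)) hf0,
    ae_integrable_of_energy hβ hμ hT (measurable_comoving hS.1) hU2,
    ae_integrable_of_energy hβ hμ hT (measurable_comoving hS.2.1) hH2] with q h0 hUq hHq
  have hi (η : ℝ) (hη : 0 < η) : Integrable (fun t => comoving U t q *
      ((deriv (ramp η) t : ℝ) : ℂ)) (volume.restrict (Ioo 0 T)) :=
    hUq.mul_bdd (c := 2 * C / η)
      (Complex.continuous_ofReal.comp (continuous_deriv_ramp η)).aestronglyMeasurable
      (ae_of_all _ fun t => by simpa using abs_deriv_ramp_le hC hη t)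
  have hk : Integrable (fun t => comoving H t q * ((ramp ε t - ramp δ t : ℝ) : ℂ))
      (volume.restrict (Ioo 0 T)) :=
    hHq.mul_bdd (c := 1) (Complex.continuous_ofReal.comp
      ((contDiff_ramp ε).continuous.sub (contDiff_ramp δ).continuous)).aestronglyMeasurable
      (ae_of_all _ fun t => by
        rw [Complex.norm_real, Real.norm_eq_abs]; exact abs_ramp_sub_le ε δ t)
  have hd (t : ℝ) : deriv (fun x => ramp ε x - ramp δ x) t =
      deriv (ramp ε) t - deriv (ramp δ) t :=
    deriv_fun_sub ((contDiff_ramp ε).differentiable (by simp) t)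
      ((contDiff_ramp δ).differentiable (by simp) t)
  have h1 : (∫ t in Ioo 0 T, comoving U t q * ((deriv (ramp ε) t : ℝ) : ℂ)) -
      (∫ t in Ioo 0 T, comoving U t q * ((deriv (ramp δ) t : ℝ) : ℂ)) +
      ∫ t in Ioo 0 T, comoving H t q * ((ramp ε t - ramp δ t : ℝ) : ℂ) = 0 := by
    rw [← integral_sub (hi ε hε) (hi δ hδ), ← integral_add (f := fun t =>
      comoving U t q * ((deriv (ramp ε) t : ℝ) : ℂ) - comoving U t q * ((deriv (ramp δ) t : ℝ) : ℂ))
      ((hi ε hε).sub (hi δ hδ)) hk]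
    refine Eq.trans ?_ h0
    refine integral_congr_ae (ae_of_all _ fun t => ?_)
    simp only [hd]
    push_cast
    ring
  have h2 : ∫ t in Ioo 0 T, comoving U t q * ((deriv (ramp ε) t : ℝ) : ℂ) =
      (∫ t in Ioo 0 T, comoving U t q * ((deriv (ramp δ) t : ℝ) : ℂ)) -
      ∫ t in Ioo 0 T, comoving H t q * ((ramp ε t - ramp δ t : ℝ) : ℂ) := by
    linear_combination h1
  rw [h2]
  exact enorm_sub_le.trans (add_le_add (enorm_integral_mul_deriv_ramp_le hC hδ _)
    (enorm_integral_mul_ramp_sub_le hε hεδ _))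

/-- The weighted bound on an averaged value from energies, at the scale `δ ≈ 1 / ω_β`. -/
lemma weighted_sq_le_energy (hβ : β ∈ Ioc (0 : ℝ) 2) (hμ : μ ∈ Ioc (1 / 2 : ℝ) 1) {C a : ℝ}
    (hC : 0 < C) (ha : 0 < a) {V K : ℝ → En n × En n → ℂ} {q : En n × En n}
    (hV : Measurable fun t => V t q) (hK : Measurable fun t => K t q) {δ : ℝ}
    (hδa : a ≤ δ * om β q) (hδq : δ * om β q ≤ 1) {A : ℝ≥0∞}
    (hA : A ≤ ENNReal.ofReal (2 * C / δ) * (∫⁻ t in Ioo 0 T ∩ Iic δ, ‖V t q‖ₑ) +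
        ∫⁻ t in Ioo 0 T ∩ Iic δ, ‖K t q‖ₑ) :
    ENNReal.ofReal (om β q ^ (2 * (s + 1 / 2 - (1 - μ)))) * A ^ 2 ≤
      4 * (ENNReal.ofReal (4 * C ^ 2 * a ^ (2 * μ - 3) / (2 * μ - 1) * 8 ^ |2 * (s + 1)|) *
          energy β (s + 1) T μ V q +
        ENNReal.ofReal (1 / (2 * μ - 1) * 8 ^ |2 * s|) * energy β s T μ K q) := by
  have hω := om_pos (β := β) q
  have hδ : 0 < δ := pos_of_mul_pos_left (ha.trans_le hδa) hω.le
  have hm : 0 < 2 * μ - 1 := by linarith [hμ.1]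
  have hV2 := sq_lintegral_le_energy (s := s + 1) (T := T) hβ hμ.1 hV hδ hδq
  have hK2 := sq_lintegral_le_energy (s := s) (T := T) hβ hμ.1 hK hδ hδq
  refine (mul_le_mul_right ((pow_le_pow_left₀ zero_le hA 2).trans
    (ENNReal.add_sq_le_four _ _)) _).trans ?_
  rw [mul_left_comm, mul_add, mul_pow]
  refine mul_le_mul_right (add_le_add ?_ ?_) _
  · have e1 : ENNReal.ofReal (om β q ^ (2 * (s + 1 / 2 - (1 - μ)))) *
          ENNReal.ofReal (2 * C / δ) ^ 2 =
        ENNReal.ofReal (om β q ^ (2 * μ - 3) * (2 * C / δ) ^ 2) *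
          ENNReal.ofReal (om β q ^ (2 * (s + 1))) := by
      rw [← ENNReal.ofReal_pow (by positivity), ← ENNReal.ofReal_mul (by positivity),
        ← ENNReal.ofReal_mul (by positivity), mul_right_comm, ← Real.rpow_add hω]
      ring_nf
    rw [← mul_assoc, e1, mul_assoc]
    refine (mul_le_mul_right hV2 _).trans ?_
    rw [← mul_assoc, ← ENNReal.ofReal_mul (by positivity)]
    refine mul_le_mul_left (ENNReal.ofReal_le_ofReal ?_) _
    have e2 : om β q ^ (2 * μ - 3) * (2 * C / δ) ^ 2 *
        (δ ^ (2 * μ - 1) / (2 * μ - 1) * 8 ^ |2 * (s + 1)|) =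
        4 * C ^ 2 * (δ * om β q) ^ (2 * μ - 3) / (2 * μ - 1) * 8 ^ |2 * (s + 1)| := by
      have e3 : δ ^ (2 * μ - 1) = δ ^ (2 * μ - 3) * δ ^ 2 := by
        rw [← Real.rpow_add_natCast hδ.ne']
        congr 1
        push_cast
        ring
      rw [Real.mul_rpow hδ.le hω.le, e3]
      field_simp
      norm_num
    rw [e2]
    have e4 := Real.rpow_le_rpow_of_nonpos ha hδa (by linarith [hμ.2] : 2 * μ - 3 ≤ 0)
    gcongr
  · have e1 : ENNReal.ofReal (om β q ^ (2 * (s + 1 / 2 - (1 - μ)))) =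
        ENNReal.ofReal (om β q ^ (2 * μ - 1)) * ENNReal.ofReal (om β q ^ (2 * s)) := by
      rw [← ENNReal.ofReal_mul (by positivity), ← Real.rpow_add hω]
      ring_nf
    rw [e1, mul_assoc]
    refine (mul_le_mul_right hK2 _).trans ?_
    rw [← mul_assoc, ← ENNReal.ofReal_mul (by positivity)]
    refine mul_le_mul_left (ENNReal.ofReal_le_ofReal ?_) _
    have e2 : om β q ^ (2 * μ - 1) * (δ ^ (2 * μ - 1) / (2 * μ - 1) * 8 ^ |2 * s|) =
        (δ * om β q) ^ (2 * μ - 1) / (2 * μ - 1) * 8 ^ |2 * s| := by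
      rw [Real.mul_rpow hδ.le hω.le]
      ring
    rw [e2]
    have e3 := Real.rpow_le_one (ha.le.trans hδa) hδq hm.le
    gcongr

end FiberBound

section TraceEstimate

variable {n : ℕ} {β s T μ : ℝ}

lemma Hm1_lt_top_of_hasTrace (hβ : β ∈ Ioc (0 : ℝ) 2) (hs : -(1 / 2 : ℝ) ≤ s) (hT : 0 < T)
    {U : ℝ → En n → En n → ℂ} (hU : MeasU n U) (hfin : L2X n β s T μ U < ⊤)
    {G : En n → En n → ℂ} (hG : Measurable fun p : En n × En n => G p.1 p.2)
    (htr : HasTrace n T U G) : Hm1 n G < ⊤ := by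
  have hX : Measurable fun t => Xnorm n β s (U t) := by
    have h1 : Measurable fun p : ℝ × (En n × En n) =>
        ENNReal.ofReal (om β p.2 ^ (2 * s)) * ‖U p.1 p.2.1 p.2.2‖ₑ ^ 2 :=
      ((continuous_om_rpow hβ.1 _).measurable.comp measurable_snd).ennreal_ofReal.mul
        (Measurable.pow_const (Measurable.enorm hU) 2)
    have h2 := h1.lintegral_prod_right' (ν := (volume : Measure (En n × En n)))
    have h3 : (fun t => Xnorm n β s (U t)) = fun t => ∫⁻ q : En n × En n,
        ENNReal.ofReal (om β q ^ (2 * s)) * ‖U t q.1 q.2‖ₑ ^ 2 :=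
      funext fun t => Xnorm_eq hβ.1 (hU.apply t)
    rw [h3]
    exact h2
  have hae : ∀ᵐ t ∂(volume.restrict (Ioo 0 T)), Xnorm n β s (U t) < ⊤ := by
    have h1 : ∀ᵐ t ∂(volume.restrict (Ioo 0 T)),
        ENNReal.ofReal (t ^ (2 - 2 * μ)) * Xnorm n β s (U t) < ⊤ :=
      ae_lt_top ((measurable_id.pow_const _).ennreal_ofReal.mul hX) hfin.ne
    filter_upwards [h1, ae_restrict_mem measurableSet_Ioo] with t h2 ht
    refine ENNReal.lt_top_of_mul_ne_top_right h2.ne ?_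
    exact (ENNReal.ofReal_pos.2 (Real.rpow_pos_of_pos ht.1 _)).ne'
  have hev : ∀ᶠ t in nhdsWithin 0 (Ioo 0 T), Hm1 n (fun k ξ => U t k ξ - G k ξ) < ⊤ :=
    (htr.eventually (gt_mem_nhds zero_lt_one)).mono fun t h => h.trans ENNReal.one_lt_top
  rw [eventually_nhdsWithin_iff, Metric.eventually_nhds_iff] at hev
  obtain ⟨r, hr, hev⟩ := hev
  obtain ⟨t, ht, hXt⟩ : ∃ t, t ∈ Ioo 0 (min r T) ∧ Xnorm n β s (U t) < ⊤ := by
    have hpos : volume (Ioo 0 (min r T)) ≠ 0 := by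
      rw [Real.volume_Ioo, sub_zero]
      exact (ENNReal.ofReal_pos.2 (lt_min hr hT)).ne'
    have hne : (ae (volume.restrict (Ioo 0 (min r T)))).NeBot :=
      ae_neBot.2 (Measure.restrict_eq_zero.not.2 hpos)
    have h1 := ae_restrict_of_ae_restrict_of_subset
      (Ioo_subset_Ioo_right (min_le_right r T)) hae
    exact ((ae_restrict_mem measurableSet_Ioo).and h1).exists
  have hsub := hev (y := t) (by
    rw [Real.dist_eq, sub_zero, abs_of_pos ht.1]
    exact ht.2.trans_le (min_le_left _ _)) ⟨ht.1, ht.2.trans_le (min_le_right _ _)⟩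
  have hUt : Hm1 n (U t) < ⊤ := (Hm1_le_Xnorm hβ (by linarith) (hU.apply t)).trans_lt
    (ENNReal.mul_lt_top (by norm_num) hXt)
  rw [Hm1_eq ((hU.apply t).sub hG)] at hsub
  rw [Hm1_eq (hU.apply t)] at hUt
  rw [Hm1_eq hG]
  have hm : Measurable fun q : En n × En n =>
      ENNReal.ofReal (hWeight q) * ‖U t q.1 q.2‖ₑ ^ 2 :=
    continuous_hWeight.measurable.ennreal_ofReal.mul ((hU.apply t).enorm.pow_const 2)
  refine lt_of_le_of_lt ?_ (ENNReal.mul_lt_top (by norm_num : (4 : ℝ≥0∞) < ⊤)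
    (ENNReal.add_lt_top.2 ⟨hUt, hsub⟩))
  rw [← lintegral_add_left hm, ← lintegral_const_mul' _ _ (by norm_num)]
  refine lintegral_mono fun q => ?_
  rw [← mul_add, mul_left_comm]
  refine mul_le_mul_right ?_ _
  have h := enorm_add_sq_le_four (U t q.1 q.2) (-(U t q.1 q.2 - G q.1 q.2))
  rwa [enorm_neg, neg_sub, add_sub_cancel] at h

lemma tendsto_comoving_sub {U : ℝ → En n → En n → ℂ} (hU : MeasU n U)
    {G : En n → En n → ℂ} (hG : Measurable fun p : En n × En n => G p.1 p.2)
    (htr : HasTrace n T U G) (hfin : Hm1 n G < ⊤) :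
    Tendsto (fun t => ∫⁻ q : En n × En n, ENNReal.ofReal (hWeight q) *
      ‖comoving U t q - G q.1 q.2‖ₑ ^ 2) (nhdsWithin 0 (Ioo 0 T)) (nhds 0) := by
  rw [Hm1_eq hG] at hfin
  have hneg : Tendsto (fun t : ℝ => -t) (nhdsWithin 0 (Ioo 0 T)) (nhds 0) := by
    have := (continuous_neg (G := ℝ)).tendsto 0
    rw [neg_zero] at this
    exact this.mono_left nhdsWithin_le_nhds
  have h1 := (tendsto_hWeight_shear_sub hG hfin).comp hneg
  have h2 := ENNReal.Tendsto.const_mul (a := 4)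
    ((ENNReal.Tendsto.const_mul (a := 3) htr (Or.inr (by norm_num))).add h1) (Or.inr (by norm_num))
  rw [mul_zero, add_zero, mul_zero] at h2
  refine tendsto_of_tendsto_of_tendsto_of_le_of_le' tendsto_const_nhds h2
    (Eventually.of_forall fun _ => zero_le) ?_
  filter_upwards [nhdsWithin_le_nhds (Metric.ball_mem_nhds (0 : ℝ) one_pos)] with t ht
  have ht' : |t| ≤ 1 := by simpa using (mem_ball_zero_iff.1 ht).le
  simp only [Function.comp_apply]
  set D : En n × En n → ℂ := fun q => U t q.1 q.2 - G q.1 q.2 with hD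
  have hDm : Measurable D := (hU.apply t).sub hG
  have h4 : ∫⁻ q, ENNReal.ofReal (hWeight q) * ‖D (shear (-t) q)‖ₑ ^ 2 ≤
      3 * Hm1 n (fun k ξ => U t k ξ - G k ξ) := by
    rw [Hm1_eq ((hU.apply t).sub hG), ← lintegral_shear t, ← lintegral_const_mul' _ _ (by norm_num)]
    refine lintegral_mono fun q => ?_
    rw [shear_neg_shear, ← mul_assoc]
    refine mul_le_mul_left ?_ _
    rw [show (3 : ℝ≥0∞) = ENNReal.ofReal 3 by norm_num, ← ENNReal.ofReal_mul (by norm_num)]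
    exact ENNReal.ofReal_le_ofReal (hWeight_shear_le ht' q)
  refine le_trans ?_ (mul_le_mul_right (add_le_add_left h4 _) _)
  have h5 : Measurable fun q : En n × En n =>
      ENNReal.ofReal (hWeight q) * ‖D (shear (-t) q)‖ₑ ^ 2 :=
    continuous_hWeight.measurable.ennreal_ofReal.mul
      ((hDm.comp (by fun_prop : Measurable (shear (-t)))).enorm.pow_const 2)
  rw [← lintegral_add_left h5, ← lintegral_const_mul' _ _ (by norm_num)]
  refine lintegral_mono fun q => ?_
  rw [← mul_add, mul_left_comm]
  refine mul_le_mul_right (le_trans (le_of_eq ?_) (enorm_add_sq_le_four _ _)) _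
  congr 2
  simp only [hD, comoving]
  ring

lemma ae_enorm_average_sub_sq_le (hβ : 0 < β) (hμ : 1 / 2 < μ) (hT : 0 < T) {C : ℝ} (hC0 : 0 < C)
    (hC : ∀ x, |deriv Real.smoothTransition x| ≤ C) {U : ℝ → En n → En n → ℂ} (hU : MeasU n U)
    (hfin : L2X n β s T μ U < ⊤) (G : En n → En n → ℂ) {ε : ℝ} (hε : 0 < ε) (hεT : ε ≤ T) :
    ∀ᵐ q : En n × En n,
      ‖(∫ t in Ioo 0 T, comoving U t q * ((deriv (ramp ε) t : ℝ) : ℂ)) - G q.1 q.2‖ₑ ^ 2 ≤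
        ENNReal.ofReal (4 * C ^ 2 / ε) *
          ∫⁻ t in Ioo 0 T ∩ Iic ε, ‖comoving U t q - G q.1 q.2‖ₑ ^ 2 := by
  rw [L2X_eq hβ hU] at hfin
  filter_upwards [ae_integrable_of_energy hβ hμ hT (measurable_comoving hU) hfin] with q hq
  have hi : Integrable (fun t => comoving U t q * ((deriv (ramp ε) t : ℝ) : ℂ))
      (volume.restrict (Ioo 0 T)) :=
    hq.mul_bdd (c := 2 * C / ε)
      (Complex.continuous_ofReal.comp (continuous_deriv_ramp ε)).aestronglyMeasurable
      (ae_of_all _ fun t => by simpa using abs_deriv_ramp_le hC hε t)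
  have hd : Integrable (fun t => ((deriv (ramp ε) t : ℝ) : ℂ)) (volume.restrict (Ioo 0 T)) :=
    ((Complex.continuous_ofReal.comp (continuous_deriv_ramp ε)).integrableOn_Icc
      (a := 0) (b := T)).mono_set Ioo_subset_Icc_self
  have heq : (∫ t in Ioo 0 T, comoving U t q * ((deriv (ramp ε) t : ℝ) : ℂ)) - G q.1 q.2 =
      ∫ t in Ioo 0 T, (comoving U t q - G q.1 q.2) * ((deriv (ramp ε) t : ℝ) : ℂ) := by
    simp only [sub_mul]
    rw [integral_sub hi (hd.const_mul _), integral_const_mul, integral_deriv_ramp hε hεT, mul_one]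
  have hm : Measurable fun t => ‖comoving U t q - G q.1 q.2‖ₑ :=
    (((measurable_comoving hU).comp (measurable_id.prodMk measurable_const)).sub
      measurable_const).enorm
  rw [heq]
  refine (pow_le_pow_left₀ zero_le (enorm_integral_mul_deriv_ramp_le hC hε _) 2).trans ?_
  have h1 := sq_lintegral_le (T := T) (μ := 1) (by norm_num) hε hm
  norm_num at h1
  rw [mul_pow]
  refine (mul_le_mul_right h1 _).trans (le_of_eq ?_)
  rw [← mul_assoc, ← ENNReal.ofReal_pow (by positivity), ← ENNReal.ofReal_mul (by positivity)]
  congr 2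
  field_simp
  norm_num

lemma tendsto_average_sub (hβ : 0 < β) (hμ : 1 / 2 < μ) (hT : 0 < T)
    {U : ℝ → En n → En n → ℂ} (hU : MeasU n U) (hfin : L2X n β s T μ U < ⊤)
    {G : En n → En n → ℂ} (hG : Measurable fun p : En n × En n => G p.1 p.2)
    (htr : HasTrace n T U G) (hGfin : Hm1 n G < ⊤) :
    Tendsto (fun ε => ∫⁻ q : En n × En n, ENNReal.ofReal (hWeight q) *
      ‖(∫ t in Ioo 0 T, comoving U t q * ((deriv (ramp ε) t : ℝ) : ℂ)) - G q.1 q.2‖ₑ ^ 2)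
      (nhdsWithin 0 (Ioo 0 T)) (nhds 0) := by
  obtain ⟨C, hC0, hC⟩ := exists_bound_deriv_smoothTransition
  have hΦ := tendsto_comoving_sub hU hG htr hGfin
  have hm : Measurable fun p : ℝ × (En n × En n) =>
      ENNReal.ofReal (hWeight p.2) * ‖comoving U p.1 p.2 - G p.2.1 p.2.2‖ₑ ^ 2 :=
    (continuous_hWeight.measurable.comp measurable_snd).ennreal_ofReal.mul
      (((measurable_comoving hU).sub (hG.comp measurable_snd)).enorm.pow_const 2)
  have key (η : ℝ≥0∞) (hη : 0 < η) : ∀ᶠ ε in nhdsWithin 0 (Ioo 0 T),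
      ∫⁻ q : En n × En n, ENNReal.ofReal (hWeight q) *
        ‖(∫ t in Ioo 0 T, comoving U t q * ((deriv (ramp ε) t : ℝ) : ℂ)) - G q.1 q.2‖ₑ ^ 2 ≤
      ENNReal.ofReal (4 * C ^ 2) * η := by
    have hev := hΦ.eventually (Iic_mem_nhds hη)
    rw [eventually_nhdsWithin_iff, Metric.eventually_nhds_iff] at hev
    obtain ⟨r, hr, hev⟩ := hev
    rw [eventually_nhdsWithin_iff, Metric.eventually_nhds_iff]
    refine ⟨r, hr, fun ε hεr hεT => ?_⟩
    rw [Real.dist_eq, sub_zero, abs_of_pos hεT.1] at hεr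
    have hS : MeasurableSet (Ioo 0 T ∩ Iic ε) := measurableSet_Ioo.inter measurableSet_Iic
    calc _ ≤ ∫⁻ q : En n × En n, ENNReal.ofReal (4 * C ^ 2 / ε) *
          ∫⁻ t in Ioo 0 T ∩ Iic ε, ENNReal.ofReal (hWeight q) *
            ‖comoving U t q - G q.1 q.2‖ₑ ^ 2 := by
          refine lintegral_mono_ae ?_
          filter_upwards [ae_enorm_average_sub_sq_le hβ hμ hT hC0 hC hU hfin G hεT.1 hεT.2.le]
            with q hq
          rw [lintegral_const_mul' _ _ ENNReal.ofReal_ne_top, mul_left_comm]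
          exact mul_le_mul_right hq _
      _ = ENNReal.ofReal (4 * C ^ 2 / ε) * ∫⁻ t in Ioo 0 T ∩ Iic ε,
          ∫⁻ q : En n × En n, ENNReal.ofReal (hWeight q) *
            ‖comoving U t q - G q.1 q.2‖ₑ ^ 2 := by
          rw [lintegral_const_mul' _ _ ENNReal.ofReal_ne_top,
            lintegral_lintegral_swap (f := fun t q => ENNReal.ofReal (hWeight q) *
              ‖comoving U t q - G q.1 q.2‖ₑ ^ 2) hm.aemeasurable]
      _ ≤ ENNReal.ofReal (4 * C ^ 2 / ε) * ∫⁻ t in Ioo 0 T ∩ Iic ε, η := by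
          refine mul_le_mul_right (setLIntegral_mono' hS fun t ht => ?_) _
          refine hev ?_ ht.1
          rw [Real.dist_eq, sub_zero, abs_of_pos ht.1.1]
          exact lt_of_le_of_lt ht.2 hεr
      _ ≤ ENNReal.ofReal (4 * C ^ 2 / ε) * (η * ENNReal.ofReal ε) := by
          rw [setLIntegral_const]
          refine mul_le_mul_right (mul_le_mul_right ?_ _) _
          calc volume (Ioo 0 T ∩ Iic ε) ≤ volume (Ioc 0 ε) :=
                measure_mono fun t ht => ⟨ht.1.1, ht.2⟩
            _ = ENNReal.ofReal ε := by rw [Real.volume_Ioc, sub_zero]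
      _ = _ := by
          rw [mul_comm η, ← mul_assoc, ← ENNReal.ofReal_mul (by have := hεT.1; positivity),
            div_mul_cancel₀ _ hεT.1.ne']
  refine ENNReal.tendsto_nhds_zero.2 fun η hη => ?_
  have hc : 0 < ENNReal.ofReal (4 * C ^ 2) := ENNReal.ofReal_pos.2 (by positivity)
  filter_upwards [key (η / ENNReal.ofReal (4 * C ^ 2))
    (ENNReal.div_pos hη.ne' ENNReal.ofReal_ne_top)] with ε hε
  rwa [ENNReal.mul_div_cancel hc.ne' ENNReal.ofReal_ne_top] at hε

lemma le_of_frequently_approx {b h : ℝ≥0∞} {g : ℂ} {E : ℝ≥0∞} {L : ℕ → ℂ} (hb : b ≠ ⊤)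
    (hh : h ≠ 0) (hh' : h ≠ ⊤) (hE : ∀ᶠ j in atTop, b * ‖L j‖ₑ ^ 2 ≤ E)
    (hL : liminf (fun j => h * ‖L j - g‖ₑ ^ 2) atTop = 0) : b * ‖g‖ₑ ^ 2 ≤ 4 * E := by
  refine ENNReal.le_of_forall_pos_le_add fun η hη _ => ?_
  have hη' : (0 : ℝ≥0∞) < h * (η / (4 * (b + 1))) := by
    refine pos_iff_ne_zero.2 (mul_ne_zero hh (ENNReal.div_pos (by simpa using hη.ne') ?_).ne')
    finiteness
  have hfr : ∃ᶠ j in atTop, h * ‖L j - g‖ₑ ^ 2 < h * (η / (4 * (b + 1))) :=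
    frequently_lt_of_liminf_lt (by isBoundedDefault) (hL ▸ hη')
  obtain ⟨j, hj, hjE⟩ := (hfr.and_eventually hE).exists
  have hj' : ‖L j - g‖ₑ ^ 2 ≤ η / (4 * (b + 1)) :=
    ((ENNReal.mul_lt_mul_iff_right hh hh').1 hj).le
  have h1 := enorm_add_sq_le_four (L j) (-(L j - g))
  rw [enorm_neg, neg_sub, add_sub_cancel] at h1
  calc b * ‖g‖ₑ ^ 2 ≤ b * (4 * (‖L j‖ₑ ^ 2 + ‖L j - g‖ₑ ^ 2)) := mul_le_mul_right h1 _
    _ = 4 * (b * ‖L j‖ₑ ^ 2) + (4 * b) * ‖L j - g‖ₑ ^ 2 := by ring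
    _ ≤ 4 * E + (4 * (b + 1)) * (η / (4 * (b + 1))) := by
        gcongr
        exact le_self_add
    _ ≤ 4 * E + η := by
        gcongr
        exact ENNReal.mul_div_le

/-- The pointwise form of the trace estimate. -/
lemma weighted_sq_trace_le (hβ : β ∈ Ioc (0 : ℝ) 2) (hμ : μ ∈ Ioc (1 / 2 : ℝ) 1) {C a : ℝ}
    (hC : 0 < C) (ha : 0 < a) (ha1 : a ≤ 1) {V K : ℝ → En n × En n → ℂ} {q : En n × En n}
    (hV : Measurable fun t => V t q) (hK : Measurable fun t => K t q) {L : ℕ → ℂ} {g : ℂ}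
    (hL : liminf (fun j => ENNReal.ofReal (hWeight q) * ‖L j - g‖ₑ ^ 2) atTop = 0)
    (hbound : ∀ i j : ℕ, i ≤ j → ‖L j‖ₑ ≤
      ENNReal.ofReal (2 * C / (a / 2 ^ (i + 1))) *
          (∫⁻ t in Ioo 0 T ∩ Iic (a / 2 ^ (i + 1)), ‖V t q‖ₑ) +
        ∫⁻ t in Ioo 0 T ∩ Iic (a / 2 ^ (i + 1)), ‖K t q‖ₑ) :
    ENNReal.ofReal (om β q ^ (2 * (s + 1 / 2 - (1 - μ)))) * ‖g‖ₑ ^ 2 ≤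
      4 * (4 * (ENNReal.ofReal
          (4 * C ^ 2 * (a / 2) ^ (2 * μ - 3) / (2 * μ - 1) * 8 ^ |2 * (s + 1)|) *
            energy β (s + 1) T μ V q +
          ENNReal.ofReal (1 / (2 * μ - 1) * 8 ^ |2 * s|) * energy β s T μ K q)) := by
  obtain ⟨i, hi1, hi2⟩ := exists_nat_pow_near (one_le_om (β := β) q) one_lt_two
  have hδa : a / 2 ≤ a / 2 ^ (i + 1) * om β q := by
    rw [pow_succ, div_mul_eq_mul_div, div_le_div_iff₀ (by positivity) (by positivity)]
    have h := mul_le_mul_of_nonneg_left hi1 (by positivity : 0 ≤ a * 2)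
    linarith
  have hδq : a / 2 ^ (i + 1) * om β q ≤ 1 := by
    rw [div_mul_eq_mul_div, div_le_one (by positivity)]
    have h := mul_le_mul ha1 hi2.le (om_pos q).le zero_le_one
    linarith
  refine le_of_frequently_approx ENNReal.ofReal_ne_top
    (ENNReal.ofReal_pos.2 (hWeight_pos q)).ne' ENNReal.ofReal_ne_top ?_ hL
  filter_upwards [eventually_ge_atTop i] with j hij
  exact weighted_sq_le_energy hβ hμ hC (half_pos ha) hV hK hδa hδq (hbound i j hij)

lemma exists_trace_bound (n : ℕ) (hβ : β ∈ Ioc (0 : ℝ) 2) (hμ : μ ∈ Ioc (1 / 2 : ℝ) 1)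
    (hs : -(1 / 2 : ℝ) ≤ s) (hT : 0 < T) :
    ∃ C : ℝ, 0 < C ∧ ∀ G : En n → En n → ℂ, Measurable (fun p : En n × En n => G p.1 p.2) →
      ∀ U H : ℝ → En n → En n → ℂ, SolSpace n β s T μ U H → HasTrace n T U G →
        Xnorm n β (s + 1 / 2 - (1 - μ)) G ≤
          ENNReal.ofReal C * (L2X n β s T μ H + L2X n β (s + 1) T μ U) := by
  obtain ⟨C, hC0, hC⟩ := exists_bound_deriv_smoothTransition
  set T' : ℝ := min T 1 with hT'
  have hT'0 : 0 < T' := lt_min hT one_pos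
  have hm : 0 < 2 * μ - 1 := by linarith [hμ.1]
  obtain ⟨c1, hc1⟩ : ∃ c : ℝ,
    c = 4 * C ^ 2 * (T' / 2) ^ (2 * μ - 3) / (2 * μ - 1) * 8 ^ |2 * (s + 1)| := ⟨_, rfl⟩
  obtain ⟨c2, hc2⟩ : ∃ c : ℝ, c = 1 / (2 * μ - 1) * 8 ^ |2 * s| := ⟨_, rfl⟩
  have hc1p : 0 < c1 := by rw [hc1]; positivity
  have hc2p : 0 < c2 := by rw [hc2]; positivity
  refine ⟨16 * (c1 + c2), by positivity, fun G hG U H hS htr => ?_⟩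
  have hU := hS.1
  have hH := hS.2.1
  have hVm := measurable_comoving hU
  have hKm := measurable_comoving hH
  have hGfin := Hm1_lt_top_of_hasTrace hβ hs hT hU hS.2.2.2.1 hG htr
  set δ : ℕ → ℝ := fun i => T' / 2 ^ (i + 1) with hδdef
  have hδ0 (i : ℕ) : 0 < δ i := by positivity
  have hδlt (i : ℕ) : δ i < T :=
    (div_lt_self hT'0 (one_lt_pow₀ one_lt_two (by simp))).trans_le (min_le_left _ _)
  have hδmono {i j : ℕ} (hij : i ≤ j) : δ j ≤ δ i := by
    simp only [hδdef]
    gcongr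
    norm_num
  have hδlim : Tendsto δ atTop (nhdsWithin 0 (Ioo 0 T)) := by
    refine tendsto_nhdsWithin_iff.2 ⟨?_, Eventually.of_forall fun i => ⟨hδ0 i, hδlt i⟩⟩
    exact tendsto_const_nhds.div_atTop
      ((tendsto_pow_atTop_atTop_of_one_lt one_lt_two).comp (tendsto_add_atTop_nat 1))
  set L : ℕ → En n × En n → ℂ := fun j q =>
    ∫ t in Ioo 0 T, comoving U t q * ((deriv (ramp (δ j)) t : ℝ) : ℂ) with hLdef
  have hLm (j : ℕ) : Measurable (L j) := by
    have h1 : Measurable fun p : ℝ × (En n × En n) =>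
        comoving U p.1 p.2 * ((deriv (ramp (δ j)) p.1 : ℝ) : ℂ) :=
      hVm.mul (Complex.measurable_ofReal.comp
        ((continuous_deriv_ramp _).measurable.comp measurable_fst))
    exact (h1.stronglyMeasurable.integral_prod_left' (μ := volume.restrict (Ioo 0 T))).measurable
  have hconv := (tendsto_average_sub hβ.1 hμ.1 hT hU hS.2.2.2.1 hG htr hGfin).comp hδlim
  have hlimm (j : ℕ) : Measurable fun q : En n × En n =>
      ENNReal.ofReal (hWeight q) * ‖L j q - G q.1 q.2‖ₑ ^ 2 :=
    continuous_hWeight.measurable.ennreal_ofReal.mul (((hLm j).sub hG).enorm.pow_const 2)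
  have hliminf : ∀ᵐ q : En n × En n,
      liminf (fun j => ENNReal.ofReal (hWeight q) * ‖L j q - G q.1 q.2‖ₑ ^ 2) atTop = 0 := by
    have h1 : ∫⁻ q : En n × En n,
        liminf (fun j => ENNReal.ofReal (hWeight q) * ‖L j q - G q.1 q.2‖ₑ ^ 2) atTop ≤
        liminf (fun j => ∫⁻ q : En n × En n,
          ENNReal.ofReal (hWeight q) * ‖L j q - G q.1 q.2‖ₑ ^ 2) atTop :=
      lintegral_liminf_le hlimm
    have h2 : liminf (fun j => ∫⁻ q : En n × En n,
        ENNReal.ofReal (hWeight q) * ‖L j q - G q.1 q.2‖ₑ ^ 2) atTop = 0 := hconv.liminf_eq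
    rw [h2] at h1
    have hmeas : Measurable fun q : En n × En n =>
        liminf (fun j => ENNReal.ofReal (hWeight q) * ‖L j q - G q.1 q.2‖ₑ ^ 2) atTop :=
      Measurable.liminf hlimm
    exact (lintegral_eq_zero_iff hmeas).1 (le_antisymm h1 zero_le)
  have hbound : ∀ᵐ q : En n × En n, ∀ i j : ℕ, i ≤ j → ‖L j q‖ₑ ≤
      ENNReal.ofReal (2 * C / δ i) * (∫⁻ t in Ioo 0 T ∩ Iic (δ i), ‖comoving U t q‖ₑ) +
        ∫⁻ t in Ioo 0 T ∩ Iic (δ i), ‖comoving H t q‖ₑ := by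
    refine ae_all_iff.2 fun i => ae_all_iff.2 fun j => ?_
    by_cases hij : i ≤ j
    · filter_upwards [ae_enorm_integral_deriv_ramp_le hβ.1 hμ.1 hT hC hS (hδ0 j) (hδmono hij)
        (hδlt i).le] with q hq _ using hq
    · exact ae_of_all _ fun q h => absurd h hij
  rw [L2X_eq hβ.1 hU, L2X_eq hβ.1 hH, Xnorm_eq hβ.1 hG,
    ← lintegral_add_left (measurable_energy hβ.1 hKm),
    ← lintegral_const_mul' _ _ ENNReal.ofReal_ne_top]
  refine lintegral_mono_ae ?_
  filter_upwards [hliminf, hbound] with q hq hqb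
  have hVq : Measurable fun t => comoving U t q :=
    hVm.comp (measurable_id.prodMk measurable_const)
  have hKq : Measurable fun t => comoving H t q :=
    hKm.comp (measurable_id.prodMk measurable_const)
  have h1 := weighted_sq_trace_le (s := s) hβ hμ hC0 hT'0 (min_le_right _ _) hVq hKq hq hqb
  rw [← hc1, ← hc2] at h1
  refine h1.trans ?_
  rw [ENNReal.ofReal_mul (by norm_num), show ENNReal.ofReal 16 = 4 * 4 by norm_num, ← mul_assoc,
    mul_assoc (4 * 4 : ℝ≥0∞), add_comm, mul_add (ENNReal.ofReal (c1 + c2))]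
  refine mul_le_mul_right (add_le_add ?_ ?_) _
  · exact mul_le_mul_left (ENNReal.ofReal_le_ofReal (by linarith)) _
  · exact mul_le_mul_left (ENNReal.ofReal_le_ofReal (by linarith)) _

end TraceEstimate

theorem stmt13 (n : ℕ) (hn : 1 ≤ n) (μ β s T : ℝ) (hμ : μ ∈ Ioc (1/2 : ℝ) 1)
    (hβ : β ∈ Ioc (0:ℝ) 2) (hs : -(1/2 : ℝ) ≤ s) (hT : 0 < T) :
    ∃ C₁ C₂ : ℝ, 0 < C₁ ∧ 0 < C₂ ∧
      ∀ G : En n → En n → ℂ, Measurable (fun p : En n × En n => G p.1 p.2) →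
        -- `g ∈ X_β^{s+1/2−(1−μ)}` iff `g` is the trace of some
        -- `u ∈ T_μ((0,T);X_β^s) ∩ L²_μ((0,T);X_β^{s+1})`
        ((Xnorm n β (s + 1/2 - (1 - μ)) G < ⊤
            ↔ ∃ U H : ℝ → En n → En n → ℂ, SolSpace n β s T μ U H ∧ HasTrace n T U G)
        -- and the trace norm is equivalent to the `X_β^{s+1/2−(1−μ)}` norm
        ∧ ENNReal.ofReal C₁ * (Xnorm n β (s + 1/2 - (1 - μ)) G) ^ ((1:ℝ)/2)
            ≤ traceNorm n β s T μ G
        ∧ traceNorm n β s T μ G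
            ≤ ENNReal.ofReal C₂ * (Xnorm n β (s + 1/2 - (1 - μ)) G) ^ ((1:ℝ)/2)) := by
  obtain ⟨C, hC0, hC⟩ := exists_trace_bound n hβ hμ hs hT
  obtain ⟨C', hC'0, hC'⟩ := exists_extension n hβ hμ hs hT
  have hhalf : (0 : ℝ) ≤ 1 / 2 := by norm_num
  have hCp : 0 < C ^ ((1 : ℝ) / 2) := Real.rpow_pos_of_pos hC0 _
  refine ⟨(C ^ ((1 : ℝ) / 2))⁻¹, C', inv_pos.2 hCp, hC'0, fun G hG =>
    ⟨⟨fun hfin => ?_, ?_⟩, ?_, ?_⟩⟩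
  · obtain ⟨U, H, hS, htr, -⟩ := hC' G hG hfin
    exact ⟨U, H, hS, htr⟩
  · rintro ⟨U, H, hS, htr⟩
    exact (hC G hG U H hS htr).trans_lt (ENNReal.mul_lt_top ENNReal.ofReal_lt_top
      (ENNReal.add_lt_top.2 ⟨hS.2.2.2.2.1, hS.2.2.2.2.2⟩))
  · refine le_sInf ?_
    rintro _ ⟨U, H, hS, htr, rfl⟩
    have h := (ENNReal.rpow_le_rpow (hC G hG U H hS htr) hhalf).trans_eq
      (ENNReal.mul_rpow_of_nonneg _ _ hhalf)
    rw [ENNReal.ofReal_rpow_of_pos hC0] at h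
    rw [ENNReal.ofReal_inv_of_pos hCp]
    refine (ENNReal.inv_mul_le_iff (ENNReal.ofReal_pos.2 hCp).ne' ENNReal.ofReal_ne_top).2
      (h.trans (mul_le_mul_right ?_ _))
    refine (ENNReal.rpow_add_le_add_rpow _ _ hhalf (by norm_num)).trans ?_
    rw [add_assoc]
    exact le_add_self
  · rcases eq_or_ne (Xnorm n β (s + 1 / 2 - (1 - μ)) G) ⊤ with htop | hne
    · rw [htop, ENNReal.top_rpow_of_pos (by norm_num),
        ENNReal.mul_top (ENNReal.ofReal_pos.2 hC'0).ne']
      exact le_top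
    · obtain ⟨U, H, hS, htr, hle⟩ := hC' G hG hne.lt_top
      refine le_trans ?_ hle
      exact sInf_le ⟨U, H, hS, htr, rfl⟩
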